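/- Let r̃₁, r̃₂ : ℕ_{>1} → ℕ be residue functions, and define r̃₁ ⊗ r̃₂ : ℕ_{>1} → ℕ by letting (r̃₁ ⊗ r̃₂)(d) be the unique element of {0,…,d−1} congruent to r̃₁(d) + r̃₂(d) modulo d. Then r̃₁ ⊗ r̃₂ is a residue function, and moreover T_{r̃₁} ⊗ T_{r̃₂} = T_{r̃₁ ⊗ r̃₂}, where on the left ⊗ is the well-defined operation on complete extensions of T_MSO(Fin) given by T ⊗ T' = Th(M ⊗ N) for any M ⊨ T, N ⊨ T'. -/

import Mathlib

open FirstOrder FirstOrder.Language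

namespace MSO

/-! ### The language `L_⊗` and its semantics -/

/-- The language `L_⊗`: a constant `⊥`, a unary relation `At`,
and two binary relations: `⊆` (encoded `true`) and `≤ᴱ` (encoded `false`). -/
def Lmso : Language where
  Functions := fun n => match n with | 0 => Unit | _ => Empty
  Relations := fun n => match n with | 1 => Unit | 2 => Bool | _ => Empty

/-- The constant symbol `⊥`. -/
def botC : Lmso.Constants := Unit.unit
/-- The unary relation symbol `At`. -/
def atR : Lmso.Relations 1 := Unit.unit
/-- The binary relation symbol `⊆`. -/
def subR : Lmso.Relations 2 := true
/-- The binary relation symbol `≤ᴱ`. -/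
def exleR : Lmso.Relations 2 := false

/-- The interpretation of `⊥` in an `L_⊗`-structure. -/
def botE (M : Type*) [Lmso.Structure M] : M := Structure.funMap botC ![]
/-- The interpretation of `At` in an `L_⊗`-structure. -/
def atE {M : Type*} [Lmso.Structure M] (a : M) : Prop := Structure.RelMap atR ![a]
/-- The interpretation of `⊆` in an `L_⊗`-structure. -/
def subE {M : Type*} [Lmso.Structure M] (a b : M) : Prop := Structure.RelMap subR ![a, b]
/-- The interpretation of `≤ᴱ` in an `L_⊗`-structure. -/
def exleE {M : Type*} [Lmso.Structure M] (a b : M) : Prop := Structure.RelMap exleR ![a, b]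

/-- The monadic second order version `M̃SO(α)` of a linear order `α`, as an `L_⊗`-structure:
the universe is the powerset of `α`, `⊆` is inclusion, `⊥` is `∅`, `At` holds of singletons,
and `A ≤ᴱ B` iff there are `a ∈ A` and `b ∈ B` with `a < b`. -/
instance msoStructure (α : Type*) [LinearOrder α] : Lmso.Structure (Set α) where
  funMap := fun {n} f _ => match n, f with
    | 0, _ => (∅ : Set α)
  RelMap := fun {n} r v => match n, r with
    | 1, _ => ∃ a : α, v 0 = {a}
    | 2, true => v 0 ⊆ v 1
    | 2, false => ∃ a ∈ v 0, ∃ b ∈ v 1, a < b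

/-- `MSO(n)`, the monadic second order version of the `n`-element linear order. -/
abbrev MSOn (n : ℕ) : Type := Set (Fin n)

/-- The operation `⊗` on `L_⊗`-structures: the universe is the product, `⊆` is componentwise,
`⊥` is the pair of bottoms, `At` holds of the atoms (minimal non-bottom elements) of the
resulting order, and `(A,B) ≤ᴱ (C,D)` iff (`A ≠ ⊥` and `D ≠ ⊥`), or `A ≤ᴱ C`, or `B ≤ᴱ D`. -/
instance tensorStructure (M N : Type*) [Lmso.Structure M] [Lmso.Structure N] :
    Lmso.Structure (M × N) where
  funMap := fun {n} f _ => match n, f with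
    | 0, _ => (botE M, botE N)
  RelMap := fun {n} r v => match n, r with
    | 1, _ => v 0 ≠ (botE M, botE N) ∧
        ∀ q : M × N, subE q.1 (v 0).1 → subE q.2 (v 0).2 →
          q = (botE M, botE N) ∨ q = v 0
    | 2, true => subE (v 0).1 (v 1).1 ∧ subE (v 0).2 (v 1).2
    | 2, false => ((v 0).1 ≠ botE M ∧ (v 1).2 ≠ botE N) ∨
        exleE (v 0).1 (v 1).1 ∨ exleE (v 0).2 (v 1).2

/-! ### Formulas -/

/-- Bounded `L_⊗`-formulas with no free (outer) variables. -/
abbrev BF (n : ℕ) := Lmso.BoundedFormula Empty n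

/-- The `i`-th de Bruijn variable as a term. -/
def tv {n : ℕ} (i : Fin n) : Lmso.Term (Empty ⊕ Fin n) := Term.var (Sum.inr i)
/-- The constant `⊥` as a term. -/
def tb {n : ℕ} : Lmso.Term (Empty ⊕ Fin n) := Constants.term botC

def sub' {n : ℕ} (i j : Fin n) : BF n := subR.boundedFormula₂ (tv i) (tv j)
def exle' {n : ℕ} (i j : Fin n) : BF n := exleR.boundedFormula₂ (tv i) (tv j)
def at' {n : ℕ} (i : Fin n) : BF n := atR.boundedFormula₁ (tv i)
def eq' {n : ℕ} (i j : Fin n) : BF n := Term.bdEqual (tv i) (tv j)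
def isBot' {n : ℕ} (i : Fin n) : BF n := Term.bdEqual (tv i) tb
def botSub' {n : ℕ} (i : Fin n) : BF n := subR.boundedFormula₂ tb (tv i)

/-- Finite conjunction. -/
def bigAnd {n : ℕ} (l : List (BF n)) : BF n := l.foldr (· ⊓ ·) ⊤
/-- Finite disjunction. -/
def bigOr {n : ℕ} (l : List (BF n)) : BF n := l.foldr (· ⊔ ·) ⊥

/-- `k` is the meet of `i` and `j` (with respect to `⊆`). -/
def isMeet {n : ℕ} (k i j : Fin n) : BF n :=
  sub' k i ⊓ sub' k j ⊓
    ∀' ((sub' (Fin.last n) i.castSucc ⊓ sub' (Fin.last n) j.castSucc) ⟹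
      sub' (Fin.last n) k.castSucc)

/-- `k` is the join of `i` and `j` (with respect to `⊆`). -/
def isJoin {n : ℕ} (k i j : Fin n) : BF n :=
  sub' i k ⊓ sub' j k ⊓
    ∀' ((sub' i.castSucc (Fin.last n) ⊓ sub' j.castSucc (Fin.last n)) ⟹
      sub' k.castSucc (Fin.last n))

/-- The meet of `i` and `j` is `⊥`. -/
def meetIsBot {n : ℕ} (i j : Fin n) : BF n :=
  ∀' ((sub' (Fin.last n) i.castSucc ⊓ sub' (Fin.last n) j.castSucc) ⟹ isBot' (Fin.last n))

/-- The join of `i` and `j` is the top element. -/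
def joinIsTop {n : ℕ} (i j : Fin n) : BF n :=
  ∀' ((sub' i.castSucc (Fin.last n) ⊓ sub' j.castSucc (Fin.last n)) ⟹
    ∀' (sub' (Fin.last (n + 1)) ((Fin.last n).castSucc)))

/-- `j` is a (Boolean) complement of `i`. -/
def isComplOf {n : ℕ} (j i : Fin n) : BF n := meetIsBot i j ⊓ joinIsTop i j

/-- `i` is an atom: non-bottom, and minimal among non-bottom elements. -/
def isAtomDef {n : ℕ} (i : Fin n) : BF n :=
  ∼(isBot' i) ⊓
    ∀' (sub' (Fin.last n) i.castSucc ⟹ (isBot' (Fin.last n) ⊔ eq' (Fin.last n) i.castSucc))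

/-! ### The base theory `T_base` -/

def axRefl : Lmso.Sentence := ∀' sub' 0 0
def axAntisymm : Lmso.Sentence := ∀' ∀' ((sub' 0 1 ⊓ sub' 1 0) ⟹ eq' 0 1)
def axTrans : Lmso.Sentence := ∀' ∀' ∀' ((sub' 0 1 ⊓ sub' 1 2) ⟹ sub' 0 2)
def axBotLe : Lmso.Sentence := ∀' botSub' 0
def axTop : Lmso.Sentence := ∃' ∀' (sub' 1 0)
def axMeet : Lmso.Sentence := ∀' ∀' ∃' (isMeet 2 0 1)
def axJoin : Lmso.Sentence := ∀' ∀' ∃' (isJoin 2 0 1)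
def axCompl : Lmso.Sentence := ∀' ∃' (isComplOf 1 0)
def axDistrib : Lmso.Sentence :=
  ∀' ∀' ∀' ∀' ∀' ∀' ∀' ∀'
    ((isMeet 3 0 1 ⊓ isMeet 4 0 2 ⊓ isJoin 5 1 2 ⊓ isMeet 6 0 5 ⊓ isJoin 7 3 4) ⟹ sub' 6 7)
def axAt : Lmso.Sentence := ∀' (at' 0 ⇔ isAtomDef 0)
def axAtomic : Lmso.Sentence := ∀' (∼(isBot' 0) ⟹ ∃' (at' 1 ⊓ sub' 1 0))
def axIrrefl : Lmso.Sentence := ∀' (at' 0 ⟹ ∼(exle' 0 0))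
def axTransAt : Lmso.Sentence :=
  ∀' ∀' ∀' ((at' 0 ⊓ at' 1 ⊓ at' 2 ⊓ exle' 0 1 ⊓ exle' 1 2) ⟹ exle' 0 2)
def axTrich : Lmso.Sentence :=
  ∀' ∀' ((at' 0 ⊓ at' 1) ⟹ (exle' 0 1 ⊔ eq' 0 1 ⊔ exle' 1 0))
def axExleDef : Lmso.Sentence :=
  ∀' ∀' (exle' 0 1 ⇔ ∃' ∃' (at' 2 ⊓ at' 3 ⊓ sub' 2 0 ⊓ sub' 3 1 ⊓ exle' 2 3))

/-- The comprehension axiom for a formula `η(x; Y₁,…,Yₙ)` (with `x` the last variable):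
`∀ Ȳ ∃ X ∀ x (At x → (x ⊆ X ↔ η(x; Ȳ)))`. -/
def compAx {n : ℕ} (η : BF (n + 1)) : Lmso.Sentence :=
  BoundedFormula.alls (∃' ∀' (at' (Fin.last (n + 1)) ⟹
    (sub' (Fin.last (n + 1)) ((Fin.last n).castSucc) ⇔ η.liftAt 1 n)))

/-- The base theory `T_base`: an atomic Boolean algebra under `⊆` with bottom `⊥`, `At`
holding exactly of the atoms, `≤ᴱ` linearly ordering the atoms and determined by its
restriction to the atoms, together with the comprehension scheme. -/
def Tbase : Lmso.Theory :=
  {axRefl, axAntisymm, axTrans, axBotLe, axTop, axMeet, axJoin, axCompl, axDistrib,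
    axAt, axAtomic, axIrrefl, axTransAt, axTrich, axExleDef} ∪
  ⋃ n : ℕ, Set.range (compAx (n := n))

/-! ### The theory `T_MSO(Fin)` -/

/-- `i` is the `≤ᴱ`-least atom. -/
def isLeastAtom {n : ℕ} (i : Fin n) : BF n :=
  at' i ⊓ ∀' (at' (Fin.last n) ⟹ ∼(exle' (Fin.last n) i.castSucc))

/-- `i` is the `≤ᴱ`-greatest atom. -/
def isGreatestAtom {n : ℕ} (i : Fin n) : BF n :=
  at' i ⊓ ∀' (at' (Fin.last n) ⟹ ∼(exle' i.castSucc (Fin.last n)))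

/-- `j` is the immediate `≤ᴱ`-successor of the atom `i`. -/
def isSuccOf {n : ℕ} (j i : Fin n) : BF n :=
  at' i ⊓ at' j ⊓ exle' i j ⊓
    ∀' ((at' (Fin.last n) ⊓ exle' i.castSucc (Fin.last n)) ⟹
      (eq' (Fin.last n) j.castSucc ⊔ exle' j.castSucc (Fin.last n)))

def axLeastAtom : Lmso.Sentence := (∃' at' 0) ⟹ ∃' isLeastAtom 0
def axGreatestAtom : Lmso.Sentence := (∃' at' 0) ⟹ ∃' isGreatestAtom 0
def axSucc : Lmso.Sentence :=
  ∀' ((at' 0 ⊓ ∃' (at' 1 ⊓ exle' 0 1)) ⟹ ∃' isSuccOf 1 0)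
def axPred : Lmso.Sentence :=
  ∀' ((at' 0 ⊓ ∃' (at' 1 ⊓ exle' 1 0)) ⟹ ∃' isSuccOf 0 1)
def axLeastIn : Lmso.Sentence :=
  ∀' (∼(isBot' 0) ⟹ ∃' (at' 1 ⊓ sub' 1 0 ⊓ ∀' ((at' 2 ⊓ sub' 2 0) ⟹ ∼(exle' 2 1))))

/-- The theory `T_MSO(Fin)`: `T_base` together with axioms saying that the ordering of the
atoms is discrete with endpoints, and every non-bottom element contains a least atom. -/
def TMSOFin : Lmso.Theory :=
  Tbase ∪ {axLeastAtom, axGreatestAtom, axSucc, axPred, axLeastIn}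

/-! ### Quantifier rank, unnested formulas, and `≈ₖ` -/

/-- Quantifier rank of a bounded formula. -/
def qr : ∀ {n : ℕ}, BF n → ℕ
  | _, BoundedFormula.falsum => 0
  | _, BoundedFormula.equal _ _ => 0
  | _, BoundedFormula.rel _ _ => 0
  | _, BoundedFormula.imp f g => max (qr f) (qr g)
  | _, BoundedFormula.all f => qr f + 1

/-- A formula is unnested if every atomic subformula is of one of the forms
`x = y`, `c = y`, or `R x̄` with the `xᵢ`, `y` variables (Hodges). -/
def IsUnnested : ∀ {n : ℕ}, BF n → Prop
  | _, BoundedFormula.falsum => True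
  | _, BoundedFormula.equal s t =>
      (∃ i j, s = Term.var i ∧ t = Term.var j) ∨
      (∃ (c : Lmso.Constants) (j : _), s = Constants.term c ∧ t = Term.var j)
  | _, BoundedFormula.rel _ ts => ∀ i, ∃ j, ts i = Term.var j
  | _, BoundedFormula.imp f g => IsUnnested f ∧ IsUnnested g
  | _, BoundedFormula.all f => IsUnnested f

/-- `M ≈ₖ N` : `M` and `N` satisfy the same unnested `L_⊗`-sentences of quantifier
rank at most `k`. -/
def EquivK (k : ℕ) (M N : Type*) [Lmso.Structure M] [Lmso.Structure N] : Prop :=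
  ∀ φ : Lmso.Sentence, IsUnnested φ → qr φ ≤ k → (M ⊨ φ ↔ N ⊨ φ)

/-! ### The sentences `ρ_{d,h}`, `ψ_{>n}`, `ψ_{=n}` -/

/-- The index (in `Fin d`) of `A_h` among `A₁, …, A_d`, identifying `h = 0` with `h = d`. -/
def aIdx (d h : ℕ) (hd : 0 < d) : Fin d := ⟨(h + d - 1) % d, Nat.mod_lt _ hd⟩

/-- The cyclic successor on the indices `{1, …, d}`. -/
def cyc {d : ℕ} (j : Fin d) : Fin d := ⟨((j : ℕ) + 1) % d, Nat.mod_lt _ j.pos⟩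

/-- The sentence `ρ_{d,h}`: there is a partition of the atoms into `d` non-bottom elements
`A₁, …, A_d` such that the least atom is in `A₁`, the immediate successor of an atom lying in
`A_j` lies in `A_{j+1}` (cyclically), and the greatest atom is in `A_h`. -/
def rho (d h : ℕ) : Lmso.Sentence :=
  if hd : 0 < d then
    BoundedFormula.exs (n := d) (
      -- each `A_i` is non-bottom
      bigAnd ((List.finRange d).map fun i => ∼(isBot' i)) ⊓
      -- every atom lies in some `A_i`
      (∀' (at' (Fin.last d) ⟹
        bigOr ((List.finRange d).map fun i => sub' (Fin.last d) i.castSucc))) ⊓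
      -- the `A_i` are pairwise disjoint on atoms
      bigAnd ((List.finRange d).flatMap fun i => (List.finRange d).filterMap fun j =>
        if i.val < j.val then
          some (∀' (at' (Fin.last d) ⟹
            ∼(sub' (Fin.last d) i.castSucc ⊓ sub' (Fin.last d) j.castSucc)))
        else none) ⊓
      -- the least atom lies in `A₁`
      (∀' (isLeastAtom (Fin.last d) ⟹ sub' (Fin.last d) ((aIdx d 1 hd).castSucc))) ⊓
      -- immediate successors move cyclically through the `A_j`
      bigAnd ((List.finRange d).map fun j =>
        ∀' ∀' ((sub' ((Fin.last d).castSucc) (j.castSucc.castSucc) ⊓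
            isSuccOf (Fin.last (d + 1)) ((Fin.last d).castSucc)) ⟹
          sub' (Fin.last (d + 1)) ((cyc j).castSucc.castSucc))) ⊓
      -- the greatest atom lies in `A_h`
      (∀' (isGreatestAtom (Fin.last d) ⟹ sub' (Fin.last d) ((aIdx d h hd).castSucc))))
  else ⊥

/-- The list of formulas `xᵢ ≠ xⱼ` for `i < j < n`. -/
def distinctPairs (n : ℕ) : List (BF n) :=
  (List.finRange n).flatMap fun i => (List.finRange n).filterMap fun j =>
    if i.val < j.val then some (∼(eq' i j)) else none

/-- `ψ_{>n}` : there exist at least `n + 1` distinct atoms. -/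
def psiGt (n : ℕ) : Lmso.Sentence :=
  BoundedFormula.exs (n := n + 1)
    (bigAnd ((List.finRange (n + 1)).map fun i => at' i) ⊓ bigAnd (distinctPairs (n + 1)))

/-- `ψ_{=n}` : there exist exactly `n` distinct atoms. -/
def psiEq (n : ℕ) : Lmso.Sentence :=
  BoundedFormula.exs (n := n)
    (bigAnd ((List.finRange n).map fun i => at' i) ⊓ bigAnd (distinctPairs n) ⊓
      ∀' (at' (Fin.last n) ⟹ bigOr ((List.finRange n).map fun i => eq' (Fin.last n) i.castSucc)))

/-! ### Residue functions and the theories `T_r̃` -/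

/-- A residue function `ℙ × ℕ_{>0} → ℕ` (conditions imposed only at primes `p` and `j ≥ 1`):
`r(p,j) < p^j` and `r(p,j+1) ≡ r(p,j) [MOD p^j]`. -/
def IsResidueFunction (r : ℕ → ℕ → ℕ) : Prop :=
  ∀ p j : ℕ, p.Prime → 1 ≤ j → r p j < p ^ j ∧ r p (j + 1) ≡ r p j [MOD p ^ j]

/-- A function `ℕ_{>1} → ℕ` is a residue function if it arises from a residue function
`ℙ × ℕ_{>0} → ℕ` as in the paper (conditions imposed only for `d > 1`). -/
def IsResidueFunctionTilde (rt : ℕ → ℕ) : Prop :=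
  ∃ r : ℕ → ℕ → ℕ, IsResidueFunction r ∧
    ∀ d : ℕ, 1 < d → rt d < d ∧
      ∀ p j : ℕ, p.Prime → 1 ≤ j → p ^ j ∣ d → rt d ≡ r p j [MOD p ^ j]

/-- The theory `T_r̃ = T_MSO(Fin) ∪ {ψ_{>n} : n ∈ ℕ} ∪ {ρ_{d,r̃(d)} : d > 1}`. -/
def Trt (rt : ℕ → ℕ) : Lmso.Theory :=
  TMSOFin ∪ Set.range psiGt ∪ {σ : Lmso.Sentence | ∃ d : ℕ, 1 < d ∧ σ = rho d (rt d)}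

/-! ### Relativization and the sum of sentences -/

/-- Relativization of a formula to the elements `⊆ v`:
each quantifier `∀ Z (…)` becomes `∀ Z (Z ⊆ v → …)`. -/
def relv : ∀ {n : ℕ}, BF n → Fin n → BF n
  | _, BoundedFormula.falsum, _ => BoundedFormula.falsum
  | _, BoundedFormula.equal s t, _ => BoundedFormula.equal s t
  | _, BoundedFormula.rel r ts, _ => BoundedFormula.rel r ts
  | _, BoundedFormula.imp f g, v => (relv f v).imp (relv g v)
  | n, BoundedFormula.all f, v =>
      BoundedFormula.all (sub' (Fin.last n) v.castSucc ⟹ relv f v.castSucc)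

/-- `i` is downward closed with respect to the `≤ᴱ`-ordering of the atoms. -/
def dwcl' {n : ℕ} (i : Fin n) : BF n :=
  ∀' ∀' ((at' ((Fin.last n).castSucc) ⊓ at' (Fin.last (n + 1)) ⊓
      sub' ((Fin.last n).castSucc) (i.castSucc.castSucc) ⊓
      exle' (Fin.last (n + 1)) ((Fin.last n).castSucc)) ⟹
    sub' (Fin.last (n + 1)) (i.castSucc.castSucc))

/-- The sentence `φ + ψ` : `∃ X (X downward closed ∧ φ^X ∧ ψ^(Xᶜ))`
(with the complement `Xᶜ` introduced by an existential quantifier). -/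
def plusSent (φ ψ : Lmso.Sentence) : Lmso.Sentence :=
  ∃' ∃' (dwcl' (0 : Fin 2) ⊓ isComplOf (1 : Fin 2) (0 : Fin 2) ⊓
    relv (φ.liftAt 2 0) (0 : Fin 2) ⊓ relv (ψ.liftAt 2 0) (1 : Fin 2))

/-! ### `FSpec` and ultimate periodicity -/

/-- `FSpec φ` : the set of `n ∈ ℕ` such that `MSO(n) ⊨ φ`. -/
def FSpec (φ : Lmso.Sentence) : Set ℕ := {n : ℕ | MSOn n ⊨ φ}

/-- A set of naturals is ultimately periodic. -/
def UltPeriodic (S : Set ℕ) : Prop :=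
  ∃ N d : ℕ, 0 < d ∧ ∀ n : ℕ, N < n → (n ∈ S ↔ n + d ∈ S)

/-! ### The language `L_MO = {⊆, <}` -/

/-- The language `L_MO` with two binary relations: `⊆` (encoded `true`) and `<`
(encoded `false`). -/
def Lmo : Language where
  Functions := fun _ => Empty
  Relations := fun n => match n with | 2 => Bool | _ => Empty

/-- The monadic second order version `MSO(α)` of a linear order `α` as an `L_MO`-structure:
`⊆` is inclusion and `<` is the ordering of `α` on singletons. -/
instance moStructure (α : Type*) [LinearOrder α] : Lmo.Structure (Set α) where
  funMap := fun f _ => f.elim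
  RelMap := fun {n} r v => match n, r with
    | 2, true => v 0 ⊆ v 1
    | 2, false => ∃ a b : α, v 0 = {a} ∧ v 1 = {b} ∧ a < b

section Realize

variable {P : Type} [Lmso.Structure P] {n : ℕ} {v : Empty → P} {xs : Fin n → P}

@[simp] theorem realize_tv (i : Fin n) : (tv i).realize (Sum.elim v xs) = xs i := rfl

@[simp] theorem realize_tb : (tb (n := n)).realize (Sum.elim v xs) = botE P :=
  Term.realize_constants.trans rfl

@[simp] theorem realize_sub (i j : Fin n) : (sub' i j).Realize v xs ↔ subE (xs i) (xs j) := by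
  simp [sub', subE]

@[simp] theorem realize_exle (i j : Fin n) : (exle' i j).Realize v xs ↔ exleE (xs i) (xs j) := by
  simp [exle', exleE]

@[simp] theorem realize_at (i : Fin n) : (at' i).Realize v xs ↔ atE (xs i) := by
  simp [at', atE]

@[simp] theorem realize_eq (i j : Fin n) : (eq' i j).Realize v xs ↔ xs i = xs j := by
  simp [eq']

@[simp] theorem realize_isBot (i : Fin n) : (isBot' i).Realize v xs ↔ xs i = botE P := by
  simp [isBot']

@[simp] theorem realize_botSub (i : Fin n) : (botSub' i).Realize v xs ↔ subE (botE P) (xs i) := by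
  simp [botSub', subE]

@[simp] theorem realize_bigAnd (l : List (BF n)) :
    (bigAnd l).Realize v xs ↔ ∀ φ ∈ l, φ.Realize v xs :=
  BoundedFormula.realize_foldr_inf l v xs

@[simp] theorem realize_bigOr (l : List (BF n)) :
    (bigOr l).Realize v xs ↔ ∃ φ ∈ l, φ.Realize v xs :=
  BoundedFormula.realize_foldr_sup l v xs

/-- `z` is the meet of `x` and `y` in the order `⊆`. -/
def IsMeetE (z x y : P) : Prop :=
  subE z x ∧ subE z y ∧ ∀ w, subE w x → subE w y → subE w z

/-- `z` is the join of `x` and `y` in the order `⊆`. -/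
def IsJoinE (z x y : P) : Prop :=
  subE x z ∧ subE y z ∧ ∀ w, subE x w → subE y w → subE z w

/-- `y` is a complement of `x` in the order `⊆`. -/
def IsComplE (y x : P) : Prop :=
  (∀ z, subE z x → subE z y → z = botE P) ∧ ∀ z, subE x z → subE y z → ∀ w, subE w z

@[simp] theorem realize_isMeet (k i j : Fin n) :
    (isMeet k i j).Realize v xs ↔ IsMeetE (xs k) (xs i) (xs j) := by
  simp [isMeet, and_assoc, IsMeetE]

@[simp] theorem realize_isJoin (k i j : Fin n) :
    (isJoin k i j).Realize v xs ↔ IsJoinE (xs k) (xs i) (xs j) := by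
  simp [isJoin, and_assoc, IsJoinE]

@[simp] theorem realize_isComplOf (j i : Fin n) :
    (isComplOf j i).Realize v xs ↔ IsComplE (xs j) (xs i) := by
  simp [isComplOf, meetIsBot, joinIsTop, IsComplE]

@[simp] theorem realize_isAtomDef (i : Fin n) : (isAtomDef i).Realize v xs ↔
    xs i ≠ botE P ∧ ∀ z, subE z (xs i) → z = botE P ∨ z = xs i := by
  simp [isAtomDef]

@[simp] theorem realize_isLeastAtom (i : Fin n) : (isLeastAtom i).Realize v xs ↔
    atE (xs i) ∧ ∀ z, atE z → ¬ exleE z (xs i) := by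
  simp [isLeastAtom]

@[simp] theorem realize_isGreatestAtom (i : Fin n) : (isGreatestAtom i).Realize v xs ↔
    atE (xs i) ∧ ∀ z, atE z → ¬ exleE (xs i) z := by
  simp [isGreatestAtom]

@[simp] theorem realize_isSuccOf (j i : Fin n) : (isSuccOf j i).Realize v xs ↔
    atE (xs i) ∧ atE (xs j) ∧ exleE (xs i) (xs j) ∧
      ∀ z, atE z → exleE (xs i) z → z = xs j ∨ exleE (xs j) z := by
  simp [isSuccOf, and_assoc]

theorem realize_compAx (η : BF (n + 1)) : P ⊨ compAx η ↔ ∀ Y : Fin n → P, ∃ X, ∀ x, atE x →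
    (subE x X ↔ η.Realize default (Fin.snoc Y x)) := by
  rw [compAx, Sentence.Realize, BoundedFormula.realize_alls]
  refine forall_congr' fun Y => ?_
  rw [BoundedFormula.realize_ex]
  refine exists_congr fun X => ?_
  rw [BoundedFormula.realize_all]
  refine forall_congr' fun x => ?_
  rw [BoundedFormula.realize_imp, BoundedFormula.realize_iff,
    BoundedFormula.realize_liftAt_one (by omega)]
  have : (Fin.snoc (Fin.snoc Y X : Fin (n + 1) → P) x : Fin (n + 2) → P) ∘
      (fun i : Fin (n + 1) => if (i : ℕ) < n then i.castSucc else i.succ) = Fin.snoc Y x := by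
    funext i
    refine Fin.lastCases ?_ (fun i => ?_) i
    · simp only [Function.comp, Fin.val_last, lt_irrefl, if_false, Fin.succ_last, Fin.snoc_last]
    · simp
  rw [this]
  simp

end Realize

variable {P : Type} [Lmso.Structure P] 

theorem realize_axRefl : P ⊨ axRefl ↔ ∀ x : P, subE x x := by
  simp [axRefl, Sentence.Realize, Formula.Realize, Fin.snoc]

theorem realize_axAntisymm : P ⊨ axAntisymm ↔ ∀ x y : P, subE x y → subE y x → x = y := by
  simp [axAntisymm, Sentence.Realize, Formula.Realize, Fin.snoc]

theorem realize_axTrans : P ⊨ axTrans ↔ ∀ x y z : P, subE x y → subE y z → subE x z := by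
  simp [axTrans, Sentence.Realize, Formula.Realize, Fin.snoc]

theorem realize_axBotLe : P ⊨ axBotLe ↔ ∀ x : P, subE (botE P) x := by
  simp [axBotLe, Sentence.Realize, Formula.Realize, Fin.snoc]

theorem realize_axTop : P ⊨ axTop ↔ ∃ y : P, ∀ x : P, subE x y := by
  simp [axTop, Sentence.Realize, Formula.Realize, Fin.snoc]

theorem realize_axMeet : P ⊨ axMeet ↔ ∀ x y : P, ∃ z, IsMeetE z x y := by
  simp [axMeet, Sentence.Realize, Formula.Realize, Fin.snoc]

theorem realize_axJoin : P ⊨ axJoin ↔ ∀ x y : P, ∃ z, IsJoinE z x y := by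
  simp [axJoin, Sentence.Realize, Formula.Realize, Fin.snoc]

theorem realize_axCompl : P ⊨ axCompl ↔ ∀ x : P, ∃ y, IsComplE y x := by
  simp [axCompl, Sentence.Realize, Formula.Realize, Fin.snoc]

theorem realize_axDistrib : P ⊨ axDistrib ↔ ∀ x y z xy xz yz l r : P, IsMeetE xy x y →
    IsMeetE xz x z → IsJoinE yz y z → IsMeetE l x yz → IsJoinE r xy xz → subE l r := by
  simp [axDistrib, Sentence.Realize, Formula.Realize, Fin.snoc]

theorem realize_axAt : P ⊨ axAt ↔ ∀ x : P, atE x ↔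
    x ≠ botE P ∧ ∀ z, subE z x → z = botE P ∨ z = x := by
  simp [axAt, Sentence.Realize, Formula.Realize, Fin.snoc]

theorem realize_axAtomic : P ⊨ axAtomic ↔
    ∀ x : P, x ≠ botE P → ∃ a, atE a ∧ subE a x := by
  simp [axAtomic, Sentence.Realize, Formula.Realize, Fin.snoc]

theorem realize_axIrrefl : P ⊨ axIrrefl ↔ ∀ x : P, atE x → ¬ exleE x x := by
  simp [axIrrefl, Sentence.Realize, Formula.Realize, Fin.snoc]

theorem realize_axTransAt : P ⊨ axTransAt ↔ ∀ x y z : P, atE x → atE y → atE z →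
    exleE x y → exleE y z → exleE x z := by
  simp [axTransAt, Sentence.Realize, Formula.Realize, Fin.snoc]

theorem realize_axTrich : P ⊨ axTrich ↔ ∀ x y : P, atE x → atE y →
    (exleE x y ∨ x = y) ∨ exleE y x := by
  simp [axTrich, Sentence.Realize, Formula.Realize, Fin.snoc]

theorem realize_axExleDef : P ⊨ axExleDef ↔ ∀ x y : P, exleE x y ↔
    ∃ a b, (((atE a ∧ atE b) ∧ subE a x) ∧ subE b y) ∧ exleE a b := by
  simp [axExleDef, Sentence.Realize, Formula.Realize, Fin.snoc]

theorem realize_axLeastAtom : P ⊨ axLeastAtom ↔ ((∃ x : P, atE x) →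
    ∃ x : P, atE x ∧ ∀ z, atE z → ¬ exleE z x) := by
  simp [axLeastAtom, Sentence.Realize, Formula.Realize, Fin.snoc]

theorem realize_axGreatestAtom : P ⊨ axGreatestAtom ↔ ((∃ x : P, atE x) →
    ∃ x : P, atE x ∧ ∀ z, atE z → ¬ exleE x z) := by
  simp [axGreatestAtom, Sentence.Realize, Formula.Realize, Fin.snoc]

/-- `y` is the immediate `≤ᴱ`-successor of the atom `x`. -/
def IsSuccE (y x : P) : Prop :=
  atE x ∧ atE y ∧ exleE x y ∧ ∀ z, atE z → exleE x z → z = y ∨ exleE y z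

theorem realize_axSucc : P ⊨ axSucc ↔ ∀ x : P, atE x → ∀ y, atE y → exleE x y →
    ∃ y, IsSuccE y x := by
  simp [axSucc, Sentence.Realize, Formula.Realize, Fin.snoc, IsSuccE]

theorem realize_axPred : P ⊨ axPred ↔ ∀ x : P, atE x → ∀ y, atE y → exleE y x →
    ∃ y, IsSuccE x y := by
  simp [axPred, Sentence.Realize, Formula.Realize, Fin.snoc, IsSuccE]

theorem realize_axLeastIn : P ⊨ axLeastIn ↔ ∀ x : P, x ≠ botE P →
    ∃ a, (atE a ∧ subE a x) ∧ ∀ b, atE b → subE b x → ¬ exleE b a := by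
  simp [axLeastIn, Sentence.Realize, Formula.Realize, Fin.snoc]

theorem realize_psiGt (n : ℕ) : P ⊨ psiGt n ↔ ∃ x : Fin (n + 1) → P,
    (∀ i, atE (x i)) ∧ Function.Injective x := by
  rw [psiGt, Sentence.Realize, BoundedFormula.realize_exs]
  refine exists_congr fun x => ?_
  simp only [BoundedFormula.realize_inf, realize_bigAnd, distinctPairs, List.mem_map,
    List.mem_finRange, true_and, List.mem_flatMap, List.mem_filterMap, forall_exists_index,
    forall_apply_eq_imp_iff, Option.ite_none_right_eq_some, Option.some.injEq,
    and_imp, realize_at, and_congr_right_iff]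
  intro _
  constructor
  · intro h i j hij
    by_contra hne
    rcases lt_or_gt_of_ne hne with hlt | hlt
    · simpa [hij] using h _ i j hlt rfl
    · simpa [hij] using h _ j i hlt rfl
  · rintro h _ i j hij rfl
    simpa using h.ne (ne_of_lt hij)

theorem realize_rho {d : ℕ} (hd : 0 < d) (h : ℕ) : P ⊨ rho d h ↔ ∃ A : Fin d → P,
    (∀ i, A i ≠ botE P) ∧ (∀ x, atE x → ∃ i, subE x (A i)) ∧
    (∀ i j, i < j → ∀ x, atE x → ¬ (subE x (A i) ∧ subE x (A j))) ∧
    (∀ x, atE x → (∀ z, atE z → ¬ exleE z x) → subE x (A (aIdx d 1 hd))) ∧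
    (∀ j x y, subE x (A j) → IsSuccE y x → subE y (A (cyc j))) ∧
    (∀ x, atE x → (∀ z, atE z → ¬ exleE x z) → subE x (A (aIdx d h hd))) := by
  rw [rho, dif_pos hd, Sentence.Realize, BoundedFormula.realize_exs]
  refine exists_congr fun x => ?_
  simp only [BoundedFormula.realize_inf, realize_bigAnd, List.mem_map,
    List.mem_finRange, true_and, List.mem_flatMap, List.mem_filterMap, forall_exists_index,
    forall_apply_eq_imp_iff, Option.ite_none_right_eq_some, Option.some.injEq,
    and_imp, and_assoc]
  refine and_congr (by simp) (and_congr (by simp) (and_congr ?_ (and_congr (by simp) 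
    (and_congr (by simp [IsSuccE]) (by simp)))))
  constructor
  · intro h i j hij
    simpa using h _ i j hij rfl
  · rintro h _ i j hij rfl
    simpa using h i j hij

section Definability

variable {P V W : Type}

/-- A map from assignments to elements given by a variable or a parameter. -/
def IsSlot (g : (V → P) → P) : Prop := ∃ i : P ⊕ V, ∀ v, g v = Sum.elim id v i

theorem IsSlot.const (p : P) : IsSlot (fun _ : V → P => p) := ⟨.inl p, fun _ => rfl⟩

theorem IsSlot.var (i : V) : IsSlot (fun v : V → P => v i) := ⟨.inr i, fun _ => rfl⟩

variable [Lmso.Structure P]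

/-- A relation on `V`-indexed tuples which is definable with parameters. -/
def Dfb (S : (V → P) → Prop) : Prop :=
  ∃ φ : Lmso.Formula (P ⊕ V), ∀ v, φ.Realize (Sum.elim id v) ↔ S v

namespace Dfb

variable {S T : (V → P) → Prop} {g h : (V → P) → P}

theorem sub (hg : IsSlot g) (hh : IsSlot h) : Dfb fun v => subE (g v) (h v) := by
  obtain ⟨i, hi⟩ := hg
  obtain ⟨j, hj⟩ := hh
  exact ⟨subR.formula₂ (.var i) (.var j), fun v => by simp [hi, hj, subE]⟩

theorem exle (hg : IsSlot g) (hh : IsSlot h) : Dfb fun v => exleE (g v) (h v) := by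
  obtain ⟨i, hi⟩ := hg
  obtain ⟨j, hj⟩ := hh
  exact ⟨exleR.formula₂ (.var i) (.var j), fun v => by simp [hi, hj, exleE]⟩

theorem atom (hg : IsSlot g) : Dfb fun v => atE (g v) := by
  obtain ⟨i, hi⟩ := hg
  exact ⟨atR.formula₁ (.var i), fun v => by simp [hi, atE]⟩

theorem eq (hg : IsSlot g) (hh : IsSlot h) : Dfb fun v => g v = h v := by
  obtain ⟨i, hi⟩ := hg
  obtain ⟨j, hj⟩ := hh
  exact ⟨Term.equal (.var i) (.var j), fun v => by simp [hi, hj]⟩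

theorem const (p : Prop) : Dfb fun _ : V → P => p := by
  by_cases h : p
  · exact ⟨⊤, fun v => by simp [h]⟩
  · exact ⟨⊥, fun v => by simp [h]⟩

theorem not (hS : Dfb S) : Dfb fun v => ¬ S v := by
  obtain ⟨φ, hφ⟩ := hS
  exact ⟨φ.not, fun v => by simp [hφ]⟩

theorem imp (hS : Dfb S) (hT : Dfb T) : Dfb fun v => S v → T v := by
  obtain ⟨φ, hφ⟩ := hS
  obtain ⟨ψ, hψ⟩ := hT
  exact ⟨φ.imp ψ, fun v => by simp [hφ, hψ]⟩

theorem and (hS : Dfb S) (hT : Dfb T) : Dfb fun v => S v ∧ T v := by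
  obtain ⟨φ, hφ⟩ := hS
  obtain ⟨ψ, hψ⟩ := hT
  exact ⟨φ ⊓ ψ, fun v => by simp [hφ, hψ]⟩

theorem or (hS : Dfb S) (hT : Dfb T) : Dfb fun v => S v ∨ T v := by
  obtain ⟨φ, hφ⟩ := hS
  obtain ⟨ψ, hψ⟩ := hT
  exact ⟨φ ⊔ ψ, fun v => by simp [hφ, hψ]⟩

theorem iff (hS : Dfb S) (hT : Dfb T) : Dfb fun v => S v ↔ T v := by
  obtain ⟨φ, hφ⟩ := hS
  obtain ⟨ψ, hψ⟩ := hT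
  exact ⟨φ.iff ψ, fun v => by simp [hφ, hψ]⟩

theorem subst {S : (W → P) → Prop} (hS : Dfb S) {g : W → (V → P) → P}
    (hg : ∀ i, IsSlot (g i)) : Dfb fun v => S fun i => g i v := by
  obtain ⟨φ, hφ⟩ := hS
  choose j hj using hg
  refine ⟨φ.relabel (Sum.elim .inl j), fun v => ?_⟩
  rw [Formula.realize_relabel]
  refine .trans (iff_of_eq (congrArg _ (funext fun i => ?_))) (hφ fun i => g i v)
  cases i <;> simp [hj]

theorem ex {S : (V → P) → P → Prop}
    (hS : Dfb fun w : V ⊕ Unit → P => S (fun i => w (.inl i)) (w (.inr ()))) :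
    Dfb fun v => ∃ x, S v x := by
  obtain ⟨φ, hφ⟩ := hS
  refine ⟨(φ.relabel (Equiv.sumAssoc P V Unit).symm).iExs Unit, fun v => ?_⟩
  rw [Formula.realize_iExs]
  have key (i : Unit → P) : (Formula.relabel (Equiv.sumAssoc P V Unit).symm φ).Realize
      (Sum.elim (Sum.elim id v) i) ↔ S v (i ()) := by
    rw [Formula.realize_relabel]
    refine .trans (iff_of_eq (congrArg _ (funext fun a => ?_))) (hφ (Sum.elim v i))
    rcases a with a | a | a <;> rfl
  simp only [key]
  exact ⟨fun ⟨i, hi⟩ => ⟨_, hi⟩, fun ⟨x, hx⟩ => ⟨fun _ => x, hx⟩⟩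

theorem all {S : (V → P) → P → Prop}
    (hS : Dfb fun w : V ⊕ Unit → P => S (fun i => w (.inl i)) (w (.inr ()))) :
    Dfb fun v => ∀ x, S v x := by
  simpa using (ex (S := fun v x => ¬ S v x) hS.not).not

theorem finite_all {ι : Type} [Finite ι] {S : ι → (V → P) → Prop} (hS : ∀ i, Dfb (S i)) :
    Dfb fun v => ∀ i, S i v := by
  choose φ hφ using hS
  refine ⟨Formula.iInf φ, fun v => ?_⟩
  simp [hφ]

theorem finite_ex {ι : Type} [Finite ι] {S : ι → (V → P) → Prop} (hS : ∀ i, Dfb (S i)) :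
    Dfb fun v => ∃ i, S i v := by
  simpa using (finite_all fun i => (hS i).not).not

theorem congr (hS : Dfb S) (h : ∀ v, S v ↔ T v) : Dfb T := by
  obtain rfl : S = T := funext fun v => propext (h v)
  exact hS

end Dfb

/-- A unary relation definable with parameters is defined by a bounded formula whose last
variable is the distinguished one. -/
theorem Dfb.exists_boundedFormula {S : P → Prop} (hS : Dfb fun v : Unit → P => S (v ())) :
    ∃ (n : ℕ) (Y : Fin n → P) (η : BF (n + 1)), ∀ x,
      η.Realize default (Fin.snoc Y x : Fin (n + 1) → P) ↔ S x := by
  classical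
  obtain ⟨φ, hφ⟩ := hS
  let A : Finset P := φ.freeVarFinset.toLeft
  let e := A.equivFin
  let r : φ.freeVarFinset → Fin (A.card + 1) := fun a => match a with
    | ⟨.inl p, hp⟩ => (e ⟨p, by simpa [A] using hp⟩).castSucc
    | ⟨.inr _, _⟩ => Fin.last _
  refine ⟨A.card, fun i => e.symm i,
    BoundedFormula.relabel (n := A.card + 1) (k := 0) (Sum.inr : _ → Empty ⊕ _)
      (BoundedFormula.restrictFreeVar φ r), fun x => ?_⟩
  rw [BoundedFormula.realize_relabel]
  rw [BoundedFormula.realize_restrictFreeVar (Sum.elim id fun _ => x)]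
  · refine .trans ?_ (hφ fun _ => x)
    exact iff_of_eq (congrArg _ (Subsingleton.elim _ _))
  · rintro ⟨a | a, ha⟩ <;> simp [r]

end Definability

/-- `f` represents the `L_⊗`-structure `P` as an algebra of subsets of the linear order `α`
which contains the singletons and satisfies comprehension. -/
structure Rep {P α : Type} [Lmso.Structure P] [LinearOrder α] (f : P → Set α) : Prop where
  inj : Function.Injective f
  sub : ∀ x y, subE x y ↔ f x ⊆ f y
  bot : f (botE P) = ∅
  atom : ∀ x, atE x ↔ ∃ a, f x = {a}
  exle : ∀ x y, exleE x y ↔ ∃ a ∈ f x, ∃ b ∈ f y, a < b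
  sing : ∀ a, ∃ x, f x = {a}
  compr : ∀ n (η : BF (n + 1)) (Y : Fin n → P), ∃ X, ∀ x, atE x →
    (subE x X ↔ η.Realize default (Fin.snoc Y x))

namespace Rep

variable {P α : Type} [Lmso.Structure P] [LinearOrder α] {f : P → Set α}

theorem sub_sing (hf : Rep f) {x y : P} {a : α} (hx : f x = {a}) : subE x y ↔ a ∈ f y := by
  rw [hf.sub, hx, Set.singleton_subset_iff]

theorem exle_sing (hf : Rep f) {x y : P} {a b : α} (hx : f x = {a}) (hy : f y = {b}) :
    exleE x y ↔ a < b := by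
  simp [hf.exle, hx, hy]

/-- Comprehension for relations definable with parameters. -/
theorem exists_of_dfb (hf : Rep f) {S : P → Prop} (hS : Dfb fun v : Unit → P => S (v ())) :
    ∃ X, ∀ a x, f x = {a} → (a ∈ f X ↔ S x) := by
  obtain ⟨n, Y, η, h⟩ := hS.exists_boundedFormula
  obtain ⟨X, hX⟩ := hf.compr n η Y
  exact ⟨X, fun a x hx => by rw [← h, ← hX x ((hf.atom x).2 ⟨a, hx⟩), hf.sub_sing hx]⟩

theorem exists_eq_of_dfb (hf : Rep f) {S : P → Prop} {s : Set α}
    (hS : Dfb fun v : Unit → P => S (v ())) (hs : ∀ a x, f x = {a} → (S x ↔ a ∈ s)) :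
    ∃ X, f X = s := by
  obtain ⟨X, hX⟩ := hf.exists_of_dfb hS
  refine ⟨X, Set.ext fun a => ?_⟩
  obtain ⟨x, hx⟩ := hf.sing a
  rw [hX a x hx, hs a x hx]

theorem exists_inter (hf : Rep f) (x y : P) : ∃ z, f z = f x ∩ f y :=
  hf.exists_eq_of_dfb (S := fun z => subE z x ∧ subE z y)
    ((Dfb.sub (.var ()) (.const x)).and (Dfb.sub (.var ()) (.const y)))
    fun _ _ h => by simp [hf.sub_sing h]

theorem exists_union (hf : Rep f) (x y : P) : ∃ z, f z = f x ∪ f y :=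
  hf.exists_eq_of_dfb (S := fun z => subE z x ∨ subE z y)
    ((Dfb.sub (.var ()) (.const x)).or (Dfb.sub (.var ()) (.const y)))
    fun _ _ h => by simp [hf.sub_sing h]

theorem exists_compl (hf : Rep f) (x : P) : ∃ z, f z = (f x)ᶜ :=
  hf.exists_eq_of_dfb (S := fun z => ¬ subE z x) (Dfb.sub (.var ()) (.const x)).not
    fun _ _ h => by simp [hf.sub_sing h]

theorem exists_univ (hf : Rep f) : ∃ z, f z = Set.univ :=
  hf.exists_eq_of_dfb (S := fun _ => True) (Dfb.const True) fun _ _ _ => by simp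

theorem exists_Iic (hf : Rep f) (a : α) : ∃ z, f z = Set.Iic a := by
  obtain ⟨x, hx⟩ := hf.sing a
  exact hf.exists_eq_of_dfb (S := fun z => ¬ exleE x z) (Dfb.exle (.const x) (.var ())).not
    fun _ _ h => by simp [hf.exle_sing hx h]

theorem isMeetE_iff (hf : Rep f) {x y z : P} : IsMeetE z x y ↔ f z = f x ∩ f y := by
  simp only [IsMeetE, hf.sub]
  constructor
  · rintro ⟨h₁, h₂, h⟩
    obtain ⟨w, hw⟩ := hf.exists_inter x y
    exact (Set.subset_inter h₁ h₂).antisymm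
      (hw ▸ h w (hw ▸ Set.inter_subset_left) (hw ▸ Set.inter_subset_right))
  · intro h
    rw [h]
    exact ⟨Set.inter_subset_left, Set.inter_subset_right, fun w => Set.subset_inter⟩

theorem isJoinE_iff (hf : Rep f) {x y z : P} : IsJoinE z x y ↔ f z = f x ∪ f y := by
  simp only [IsJoinE, hf.sub]
  constructor
  · rintro ⟨h₁, h₂, h⟩
    obtain ⟨w, hw⟩ := hf.exists_union x y
    exact Set.Subset.antisymm
      (hw ▸ h w (hw ▸ Set.subset_union_left) (hw ▸ Set.subset_union_right))
      (Set.union_subset h₁ h₂)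
  · intro h
    rw [h]
    exact ⟨Set.subset_union_left, Set.subset_union_right, fun w => Set.union_subset⟩

theorem eq_bot_iff (hf : Rep f) {x : P} : x = botE P ↔ f x = ∅ := by
  rw [← hf.bot, hf.inj.eq_iff]

/-- Order-theoretic atoms are the elements representing singletons. -/
theorem atom_iff (hf : Rep f) {x : P} :
    (∃ a, f x = {a}) ↔ x ≠ botE P ∧ ∀ z, subE z x → z = botE P ∨ z = x := by
  simp only [ne_eq, hf.eq_bot_iff, hf.sub, ← hf.inj.eq_iff]
  constructor
  · rintro ⟨a, ha⟩
    rw [ha]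
    exact ⟨by simp, fun z hz => Set.subset_singleton_iff_eq.1 hz⟩
  · rintro ⟨hne, h⟩
    obtain ⟨a, ha⟩ := Set.nonempty_iff_ne_empty.2 hne
    obtain ⟨s, hs⟩ := hf.sing a
    rcases h s (by simpa [hs] using ha) with h | h
    · simp [hs] at h
    · exact ⟨a, by rw [← h, hs]⟩

theorem models_tbase (hf : Rep f) : P ⊨ Tbase := by
  rw [Tbase, Theory.model_iff]
  rintro φ (h | h)
  · rcases h with rfl | rfl | rfl | rfl | rfl | rfl | rfl | rfl | rfl | rfl | rfl | rfl | rfl |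
      rfl | rfl
    · exact realize_axRefl.2 fun x => (hf.sub x x).2 subset_rfl
    · exact realize_axAntisymm.2 fun x y h h' =>
        hf.inj (((hf.sub x y).1 h).antisymm ((hf.sub y x).1 h'))
    · exact realize_axTrans.2 fun x y z h h' =>
        (hf.sub x z).2 (((hf.sub x y).1 h).trans ((hf.sub y z).1 h'))
    · exact realize_axBotLe.2 fun x => by simp [hf.sub, hf.bot]
    · obtain ⟨z, hz⟩ := hf.exists_univ
      exact realize_axTop.2 ⟨z, fun x => by simp [hf.sub, hz]⟩
    · exact realize_axMeet.2 fun x y => by simpa only [hf.isMeetE_iff] using hf.exists_inter x y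
    · exact realize_axJoin.2 fun x y => by simpa only [hf.isJoinE_iff] using hf.exists_union x y
    · refine realize_axCompl.2 fun x => ?_
      obtain ⟨y, hy⟩ := hf.exists_compl x
      simp only [IsComplE, hf.sub, hf.eq_bot_iff]
      refine ⟨y, fun z h h' => ?_, fun z h h' w => ?_⟩
      · rw [hy] at h'
        exact Set.subset_empty_iff.1 fun a ha => h' ha (h ha)
      · rw [hy] at h'
        intro a _
        by_cases ha : a ∈ f x
        exacts [h ha, h' ha]
    · refine realize_axDistrib.2 fun x y z xy xz yz l r => ?_
      simp only [hf.isMeetE_iff, hf.isJoinE_iff, hf.sub]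
      intro h₁ h₂ h₃ h₄ h₅
      rw [h₄, h₅, h₃, h₁, h₂, Set.inter_union_distrib_left]
    · exact realize_axAt.2 fun x => by rw [hf.atom, hf.atom_iff]
    · refine realize_axAtomic.2 fun x hx => ?_
      obtain ⟨a, ha⟩ := Set.nonempty_iff_ne_empty.2 (hf.eq_bot_iff.not.1 hx)
      obtain ⟨s, hs⟩ := hf.sing a
      exact ⟨s, (hf.atom s).2 ⟨a, hs⟩, (hf.sub_sing hs).2 ha⟩
    · refine realize_axIrrefl.2 fun x hx => ?_
      obtain ⟨a, ha⟩ := (hf.atom x).1 hx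
      simp [hf.exle_sing ha ha]
    · refine realize_axTransAt.2 fun x y z hx hy hz => ?_
      obtain ⟨a, ha⟩ := (hf.atom x).1 hx
      obtain ⟨b, hb⟩ := (hf.atom y).1 hy
      obtain ⟨c, hc⟩ := (hf.atom z).1 hz
      simpa only [hf.exle_sing ha hb, hf.exle_sing hb hc, hf.exle_sing ha hc] using lt_trans
    · refine realize_axTrich.2 fun x y hx hy => ?_
      obtain ⟨a, ha⟩ := (hf.atom x).1 hx
      obtain ⟨b, hb⟩ := (hf.atom y).1 hy
      simp only [hf.exle_sing ha hb, hf.exle_sing hb ha, ← hf.inj.eq_iff, ha, hb,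
        Set.singleton_eq_singleton_iff, or_assoc]
      exact lt_trichotomy a b
    · refine realize_axExleDef.2 fun x y => ?_
      constructor
      · intro h
        obtain ⟨a, ha, b, hb, hab⟩ := (hf.exle x y).1 h
        obtain ⟨s, hs⟩ := hf.sing a
        obtain ⟨t, ht⟩ := hf.sing b
        exact ⟨s, t, ⟨⟨⟨(hf.atom s).2 ⟨a, hs⟩, (hf.atom t).2 ⟨b, ht⟩⟩, (hf.sub_sing hs).2 ha⟩,
          (hf.sub_sing ht).2 hb⟩, (hf.exle_sing hs ht).2 hab⟩
      · rintro ⟨s, t, ⟨⟨⟨-, -⟩, h₁⟩, h₂⟩, h₃⟩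
        obtain ⟨a, ha, b, hb, hab⟩ := (hf.exle s t).1 h₃
        exact (hf.exle x y).2 ⟨a, (hf.sub s x).1 h₁ ha, b, (hf.sub t y).1 h₂ hb, hab⟩
  · obtain ⟨n, η, rfl⟩ := Set.mem_iUnion.1 h
    exact (realize_compAx η).2 (hf.compr n η)

end Rep

/-- Every model of the base theory is represented over its linear order of atoms. -/
theorem exists_rep {P : Type} [Lmso.Structure P] (hP : P ⊨ Tbase) :
    ∃ (α : Type) (_ : LinearOrder α) (f : P → Set α), Rep f := by
  classical
  rw [Tbase, Theory.model_iff] at hP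
  have refl := realize_axRefl.1 (hP _ (by simp))
  have antisymm := realize_axAntisymm.1 (hP _ (by simp))
  have trans := realize_axTrans.1 (hP _ (by simp))
  have botLe := realize_axBotLe.1 (hP _ (by simp))
  have meet := realize_axMeet.1 (hP _ (by simp))
  have join := realize_axJoin.1 (hP _ (by simp))
  have compl := realize_axCompl.1 (hP _ (by simp))
  have distrib := realize_axDistrib.1 (hP _ (by simp))
  have atDef := realize_axAt.1 (hP _ (by simp))
  have atomic := realize_axAtomic.1 (hP _ (by simp))
  have irrefl := realize_axIrrefl.1 (hP _ (by simp))
  have transAt := realize_axTransAt.1 (hP _ (by simp))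
  have trich := realize_axTrich.1 (hP _ (by simp))
  have exleDef := realize_axExleDef.1 (hP _ (by simp))
  have compr : ∀ n (η : BF (n + 1)) (Y : Fin n → P), ∃ X, ∀ x, atE x →
      (subE x X ↔ η.Realize default (Fin.snoc Y x)) := fun n η =>
    (realize_compAx η).1 (hP _ (.inr (Set.mem_iUnion.2 ⟨n, η, rfl⟩)))
  have asymm : ∀ x y : P, atE x → atE y → exleE x y → ¬ exleE y x := fun x y hx hy h h' =>
    irrefl x hx (transAt x y x hx hy hx h h')
  let α := {x : P // atE x}
  let o : LinearOrder α :=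
    { le := fun a b => a = b ∨ exleE a.1 b.1
      lt := fun a b => exleE a.1 b.1
      le_refl := fun a => .inl rfl
      le_trans := by
        rintro a b c (rfl | h) (rfl | h')
        exacts [.inl rfl, .inr h', .inr h, .inr (transAt _ _ _ a.2 b.2 c.2 h h')]
      lt_iff_le_not_ge := by
        refine fun a b => ⟨fun h => ⟨.inr h, ?_⟩, ?_⟩
        · rintro (rfl | h')
          exacts [irrefl _ b.2 h, asymm _ _ a.2 b.2 h h']
        · rintro ⟨rfl | h, h'⟩
          exacts [(h' (.inl rfl)).elim, h]
      le_antisymm := by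
        rintro a b (rfl | h) (h' | h')
        exacts [rfl, rfl, h'.symm, (asymm _ _ a.2 b.2 h h').elim]
      le_total := by
        intro a b
        rcases trich a b a.2 b.2 with (h | h) | h
        exacts [.inl (.inr h), .inl (.inl (Subtype.ext h)), .inr (.inr h)]
      toDecidableLE := Classical.decRel _ }
  have sub_atom : ∀ {x y : P}, atE y → subE x y → atE x → x = y := fun {x y} hy h hx =>
    (((atDef y).1 hy).2 x h).resolve_left ((atDef x).1 hx).1
  have sub_iff : ∀ x y : P, subE x y ↔ ∀ a : α, subE a.1 x → subE a.1 y := by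
    refine fun x y => ⟨fun h a ha => trans _ _ _ ha h, fun h => ?_⟩
    obtain ⟨c, hc⟩ := compl y
    obtain ⟨m, hm⟩ := meet x c
    obtain ⟨l, hl⟩ := meet x y
    obtain ⟨t, ht⟩ := join y c
    have hx : IsMeetE x x t := ⟨refl x, hc.2 t ht.1 ht.2.1 x, fun w hw _ => hw⟩
    have hmb : m = botE P := by
      by_contra hne
      obtain ⟨a, ha, ham⟩ := atomic m hne
      have hay := h ⟨a, ha⟩ (trans _ _ _ ham hm.1)
      exact ((atDef a).1 ha).1 (hc.1 a hay (trans _ _ _ ham hm.2.1))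
    refine trans _ _ _ (distrib x y c l m t x l hl hm ht hx ⟨refl l, ?_, fun w hw _ => hw⟩) hl.2.1
    exact hmb ▸ botLe l
  have sing : ∀ a : α, {b : α | subE b.1 a.1} = {a} := fun a => by
    ext b
    simp only [Set.mem_ofPred_eq, Set.mem_singleton_iff]
    exact ⟨fun h => Subtype.ext (sub_atom a.2 h b.2), fun h => h ▸ refl _⟩
  have inj : Function.Injective fun x : P => {a : α | subE a.1 x} := fun x y hxy =>
    antisymm x y ((sub_iff x y).2 fun a ha => (Set.ext_iff.1 hxy a).1 ha)
      ((sub_iff y x).2 fun a ha => (Set.ext_iff.1 hxy a).2 ha)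
  refine ⟨α, o, fun x => {a | subE a.1 x}, inj, sub_iff, ?_, ?_, ?_, fun a => ⟨a.1, sing a⟩,
    compr⟩
  · refine Set.eq_empty_iff_forall_notMem.2 fun a ha => ((atDef a.1).1 a.2).1 ?_
    exact antisymm _ _ ha (botLe _)
  · refine fun x => ⟨fun h => ⟨⟨x, h⟩, sing ⟨x, h⟩⟩, ?_⟩
    rintro ⟨a, ha⟩
    obtain rfl : x = a.1 := inj (ha.trans (sing a).symm)
    exact a.2
  · intro x y
    rw [exleDef]
    constructor
    · rintro ⟨a, b, ⟨⟨⟨ha, hb⟩, hax⟩, hby⟩, hab⟩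
      exact ⟨⟨a, ha⟩, hax, ⟨b, hb⟩, hby, hab⟩
    · rintro ⟨a, ha, b, hb, hab⟩
      exact ⟨a.1, b.1, ⟨⟨⟨a.2, b.2⟩, ha⟩, hb⟩, hab⟩

namespace Rep

variable {P α : Type} [Lmso.Structure P] [LinearOrder α] {f : P → Set α}

/-- The element representing a singleton. -/
noncomputable def single (hf : Rep f) (a : α) : P := (hf.sing a).choose

theorem apply_single (hf : Rep f) (a : α) : f (hf.single a) = {a} :=
  (hf.sing a).choose_spec

@[simp] theorem single_sub (hf : Rep f) {a : α} {x : P} : subE (hf.single a) x ↔ a ∈ f x :=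
  hf.sub_sing (hf.apply_single a)

@[simp] theorem single_exle (hf : Rep f) {a b : α} :
    exleE (hf.single a) (hf.single b) ↔ a < b :=
  hf.exle_sing (hf.apply_single a) (hf.apply_single b)

@[simp] theorem single_inj (hf : Rep f) {a b : α} : hf.single a = hf.single b ↔ a = b := by
  rw [← hf.inj.eq_iff]
  simp [hf.apply_single]

theorem eq_single (hf : Rep f) {a : α} {x : P} (h : f x = {a}) : x = hf.single a :=
  hf.inj (by simp [h, hf.apply_single])

theorem atE_single (hf : Rep f) (a : α) : atE (hf.single a) :=
  (hf.atom _).2 ⟨a, hf.apply_single a⟩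

theorem atE_iff (hf : Rep f) {x : P} : atE x ↔ ∃ a, x = hf.single a :=
  ⟨fun h => let ⟨a, ha⟩ := (hf.atom x).1 h; ⟨a, hf.eq_single ha⟩,
    fun ⟨a, ha⟩ => ha ▸ hf.atE_single a⟩

theorem forall_atE (hf : Rep f) {p : P → Prop} :
    (∀ x, atE x → p x) ↔ ∀ a, p (hf.single a) := by
  simp only [hf.atE_iff, forall_exists_index, forall_eq_apply_imp_iff]

theorem exists_atE (hf : Rep f) {p : P → Prop} :
    (∃ x, atE x ∧ p x) ↔ ∃ a, p (hf.single a) := by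
  simp only [hf.atE_iff]
  exact ⟨fun ⟨_, ⟨a, ha⟩, h⟩ => ⟨a, ha ▸ h⟩, fun ⟨a, h⟩ => ⟨_, ⟨a, rfl⟩, h⟩⟩

theorem single_succ (hf : Rep f) {a b : α} :
    IsSuccE (hf.single b) (hf.single a) ↔ a ⋖ b := by
  simp only [IsSuccE, hf.atE_single, true_and, hf.single_exle, hf.forall_atE, hf.single_inj, CovBy]
  refine and_congr_right fun _ => forall_congr' fun c => imp_congr_right fun _ => ?_
  rw [not_lt, le_iff_eq_or_lt, eq_comm]

theorem isSuccE_iff (hf : Rep f) {x y : P} :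
    IsSuccE y x ↔ ∃ a b, x = hf.single a ∧ y = hf.single b ∧ a ⋖ b := by
  constructor
  · intro h
    obtain ⟨a, rfl⟩ := hf.atE_iff.1 h.1
    obtain ⟨b, rfl⟩ := hf.atE_iff.1 h.2.1
    exact ⟨a, b, rfl, rfl, hf.single_succ.1 h⟩
  · rintro ⟨a, b, rfl, rfl, h⟩
    exact hf.single_succ.2 h

theorem forall_psiGt_iff (hf : Rep f) : (∀ n, P ⊨ psiGt n) ↔ Infinite α := by
  simp only [realize_psiGt]
  constructor
  · intro h
    by_contra hfin
    rw [not_infinite_iff_finite] at hfin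
    obtain ⟨x, hx, hinj⟩ := h (Nat.card α)
    choose a ha using fun i => hf.atE_iff.1 (hx i)
    have : Function.Injective a := fun i j hij => hinj (by rw [ha, ha, hij])
    simpa using Nat.card_le_card_of_injective a this
  · intro h n
    refine ⟨fun i => hf.single (Infinite.natEmbedding α i), fun i => hf.atE_single _, ?_⟩
    intro i j hij
    simpa [Fin.ext_iff] using hij

end Rep

/-- The properties of a represented structure expressing that it is a model of `Trt rt`. -/
structure Good {P α : Type} [LinearOrder α] (rt : ℕ → ℕ) (f : P → Set α) : Prop where
  infinite : Infinite α
  bot : ∃ a : α, IsBot a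
  top : ∃ a : α, IsTop a
  succ : ∀ a b : α, a < b → ∃ c, a ⋖ c
  pred : ∀ a b : α, b < a → ∃ c, c ⋖ a
  min : ∀ x, (f x).Nonempty → ∃ a, IsLeast (f x) a
  color : ∀ d, 1 < d → ∃ c : α → ZMod d, (∀ i, ∃ x, f x = c ⁻¹' {i}) ∧
    (∀ a, IsBot a → c a = 0) ∧ (∀ a b, a ⋖ b → c b = c a + 1) ∧
    ∀ a, IsTop a → c a = rt d - 1

/-- An infinite discrete order with least element contains an initial segment of order
type `ω`. -/
theorem exists_initial_seq {α : Type} [LinearOrder α] [Infinite α] (hb : ∃ a : α, IsBot a)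
    (hs : ∀ a b : α, a < b → ∃ c, a ⋖ c) :
    ∃ e : ℕ → α, IsBot (e 0) ∧ ∀ n, e n ⋖ e (n + 1) := by
  obtain ⟨a₀, ha₀⟩ := hb
  have step (a : α) (ha : (Set.Iic a).Finite) : ∃ c, a ⋖ c ∧ (Set.Iic c).Finite := by
    obtain ⟨b, hb⟩ : ∃ b, a < b := by
      by_contra! h
      exact Set.infinite_univ (ha.subset fun x _ => h x)
    obtain ⟨c, hc⟩ := hs a b hb
    refine ⟨c, hc, (ha.insert c).subset fun x hx => ?_⟩
    rcases eq_or_lt_of_le (Set.mem_Iic.1 hx) with h | h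
    · exact .inl h
    · exact .inr (not_lt.1 fun h' => hc.2 h' h)
  choose! g hg using step
  have fin (n : ℕ) : (Set.Iic (g^[n] a₀)).Finite := by
    induction n with
    | zero => exact (Set.finite_singleton a₀).subset fun x hx => le_antisymm hx (ha₀ x)
    | succ n ih => rw [Function.iterate_succ_apply']; exact (hg _ ih).2
  refine ⟨fun n => g^[n] a₀, ha₀, fun n => ?_⟩
  beta_reduce
  rw [Function.iterate_succ_apply']
  exact (hg _ (fin n)).1

theorem natCast_aIdx {d : ℕ} (hd : 0 < d) (h : ℕ) :
    (((aIdx d h hd : Fin d) : ℕ) : ZMod d) = h - 1 := by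
  simp only [aIdx, ZMod.natCast_mod]
  rw [Nat.cast_sub (by omega)]
  simp

theorem natCast_cyc {d : ℕ} (j : Fin d) : (((cyc j : Fin d) : ℕ) : ZMod d) = (j : ℕ) + 1 := by
  simp [cyc]

theorem natCast_fin_inj {d : ℕ} {i j : Fin d} : ((i : ℕ) : ZMod d) = (j : ℕ) ↔ i = j := by
  rw [ZMod.natCast_eq_natCast_iff', Nat.mod_eq_of_lt i.2, Nat.mod_eq_of_lt j.2, Fin.ext_iff]

theorem exists_fin_natCast {d : ℕ} (hd : 0 < d) (z : ZMod d) : ∃ i : Fin d, ((i : ℕ) : ZMod d) = z :=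
  haveI : NeZero d := ⟨hd.ne'⟩
  ⟨⟨z.val, z.val_lt⟩, by simp⟩

namespace Rep

variable {P α : Type} [Lmso.Structure P] [LinearOrder α] {f : P → Set α}

theorem isBot_iff {a : α} : IsBot a ↔ ∀ b, ¬ b < a := by simp [IsBot]

theorem isTop_iff {a : α} : IsTop a ↔ ∀ b, ¬ a < b := by simp [IsTop]

theorem rho_iff (hf : Rep f) {d h : ℕ} (hd : 0 < d) :
    P ⊨ rho d h ↔ ∃ c : α → ZMod d, (∀ i, ∃ x, f x = c ⁻¹' {i} ∧ (f x).Nonempty) ∧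
      (∀ a, IsBot a → c a = 0) ∧ (∀ a b, a ⋖ b → c b = c a + 1) ∧
      ∀ a, IsTop a → c a = h - 1 := by
  rw [realize_rho hd]
  simp only [hf.forall_atE, hf.single_exle, hf.single_sub, ← isBot_iff, ← isTop_iff, ne_eq,
    hf.eq_bot_iff, ← Set.nonempty_iff_ne_empty]
  constructor
  · rintro ⟨A, hne, hcov, hdisj, hbot, hsucc, htop⟩
    choose c hc using hcov
    have uniq {a i} (h : a ∈ f (A i)) : c a = i := by
      by_contra hi
      rcases lt_or_gt_of_ne hi with hlt | hlt
      exacts [hdisj _ _ hlt a ⟨hc a, h⟩, hdisj _ _ hlt a ⟨h, hc a⟩]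
    refine ⟨fun a => ((c a : ℕ) : ZMod d), fun i => ?_, fun a ha => ?_, fun a b hab => ?_,
      fun a ha => ?_⟩
    · obtain ⟨j, rfl⟩ := exists_fin_natCast hd i
      refine ⟨A j, Set.ext fun a => ?_, hne j⟩
      simp only [Set.mem_preimage, Set.mem_singleton_iff, natCast_fin_inj]
      exact ⟨uniq, fun h => h ▸ hc a⟩
    · simp [uniq (hbot a ha), natCast_aIdx]
    · have := hsucc (c a) (hf.single a) (hf.single b) (by simpa using hc a)
        (hf.single_succ.2 hab)
      simp [uniq (hf.single_sub.1 this), natCast_cyc]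
    · simp [uniq (htop a ha), natCast_aIdx]
  · rintro ⟨c, hA, hbot, hsucc, htop⟩
    choose A hA hne using fun i : Fin d => hA ((i : ℕ) : ZMod d)
    have mem {a i} : a ∈ f (A i) ↔ c a = ((i : ℕ) : ZMod d) := by simp [hA]
    refine ⟨A, hne, ?_⟩
    simp only [mem]
    refine ⟨fun a => ?_, fun i j hij a ⟨h, h'⟩ => ?_, fun a ha => ?_, ?_, fun a ha => ?_⟩
    · obtain ⟨i, hi⟩ := exists_fin_natCast hd (c a)
      exact ⟨i, hi.symm⟩
    · exact hij.ne (natCast_fin_inj.1 (h.symm.trans h'))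
    · simp [natCast_aIdx, hbot a ha]
    · intro j x y hx hxy
      obtain ⟨a, b, rfl, rfl, hab⟩ := hf.isSuccE_iff.1 hxy
      rw [hf.single_sub, mem] at hx ⊢
      rw [natCast_cyc, hsucc a b hab, hx]
    · rw [natCast_aIdx, htop a ha]

/-- A represented structure is a model of `Trt rt` iff it satisfies `Good rt`. -/
theorem models_trt_iff (hf : Rep f) (rt : ℕ → ℕ) : P ⊨ Trt rt ↔ Good rt f := by
  rw [Theory.model_iff]
  constructor
  · intro h
    have hinf : Infinite α := hf.forall_psiGt_iff.1 fun n => h _ (.inl (.inr ⟨n, rfl⟩))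
    have ax (φ) (hφ : φ ∈ ({axLeastAtom, axGreatestAtom, axSucc, axPred, axLeastIn} :
        Set Lmso.Sentence)) : P ⊨ φ := h φ (.inl (.inl (.inr hφ)))
    obtain ⟨a₀⟩ : Nonempty α := inferInstance
    have h1 := realize_axLeastAtom.1 (ax _ (by simp)) ⟨_, hf.atE_single a₀⟩
    have h2 := realize_axGreatestAtom.1 (ax _ (by simp)) ⟨_, hf.atE_single a₀⟩
    have h3 := realize_axSucc.1 (ax _ (by simp))
    have h4 := realize_axPred.1 (ax _ (by simp))
    have h5 := realize_axLeastIn.1 (ax _ (by simp))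
    simp only [hf.forall_atE, hf.exists_atE, hf.single_exle, ← isBot_iff, ← isTop_iff] at h1 h2 h3 h4
    refine ⟨hinf, h1, h2, fun a b hab => ?_, fun a b hab => ?_, fun x hx => ?_, fun d hd => ?_⟩
    · obtain ⟨y, hy⟩ := h3 a b hab
      obtain ⟨b, rfl⟩ := hf.atE_iff.1 hy.2.1
      exact ⟨b, hf.single_succ.1 hy⟩
    · obtain ⟨y, hy⟩ := h4 a b hab
      obtain ⟨b, rfl⟩ := hf.atE_iff.1 hy.1
      exact ⟨b, hf.single_succ.1 hy⟩
    · have := h5 x (hf.eq_bot_iff.not.2 (Set.nonempty_iff_ne_empty.1 hx))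
      simpa [and_assoc, hf.forall_atE, hf.exists_atE, IsLeast, lowerBounds] using this
    · obtain ⟨c, h1, h2, h3, h4⟩ := (hf.rho_iff (by omega)).1 (h (rho d (rt d)) (.inr ⟨d, hd, rfl⟩))
      exact ⟨c, fun i => (h1 i).imp fun _ => And.left, h2, h3, h4⟩
  · rintro hg φ (((h | h) | h) | ⟨d, hd, rfl⟩)
    · exact (Theory.model_iff _).1 hf.models_tbase φ h
    · rcases h with rfl | rfl | rfl | rfl | rfl
      · refine realize_axLeastAtom.2 fun _ => ?_
        simpa only [hf.forall_atE, hf.exists_atE, hf.single_exle, ← isBot_iff] using hg.bot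
      · refine realize_axGreatestAtom.2 fun _ => ?_
        simpa only [hf.forall_atE, hf.exists_atE, hf.single_exle, ← isTop_iff] using hg.top
      · rw [realize_axSucc]
        simp only [hf.forall_atE, hf.single_exle]
        intro a b hab
        obtain ⟨c, hc⟩ := hg.succ a b hab
        exact ⟨_, hf.single_succ.2 hc⟩
      · rw [realize_axPred]
        simp only [hf.forall_atE, hf.single_exle]
        intro a b hab
        obtain ⟨c, hc⟩ := hg.pred a b hab
        exact ⟨_, hf.single_succ.2 hc⟩
      · refine realize_axLeastIn.2 fun x hx => ?_
        have := hg.min x (Set.nonempty_iff_ne_empty.2 (hf.eq_bot_iff.not.1 hx))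
        simpa [and_assoc, hf.forall_atE, hf.exists_atE, IsLeast, lowerBounds] using this
    · obtain ⟨n, rfl⟩ := h
      exact hf.forall_psiGt_iff.2 hg.infinite n
    · rw [hf.rho_iff (by omega)]
      obtain ⟨c, h1, h2, h3, h4⟩ := hg.color d hd
      have := hg.infinite
      obtain ⟨e, he₀, he⟩ := exists_initial_seq hg.bot hg.succ
      have ce (n : ℕ) : c (e n) = n := by
        induction n with
        | zero => simp [h2 _ he₀]
        | succ n ih => rw [h3 _ _ (he n), ih]; simp
      refine ⟨c, fun i => ?_, h2, h3, h4⟩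
      obtain ⟨x, hx⟩ := h1 i
      obtain ⟨j, rfl⟩ := exists_fin_natCast (by omega) i
      exact ⟨x, hx, e j, by simp [hx, ce]⟩

end Rep

section LexSum

variable {M N α β : Type}

/-- The representation of a product over the ordered sum. -/
def tensorRep (f : M → Set α) (g : N → Set β) (p : M × N) : Set (α ⊕ₗ β) :=
  {z | Sum.elim (· ∈ f p.1) (· ∈ g p.2) (ofLex z)}

@[simp] theorem inl_mem_tensorRep {f : M → Set α} {g : N → Set β} {p : M × N} {a : α} :
    toLex (.inl a) ∈ tensorRep f g p ↔ a ∈ f p.1 := Iff.rfl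

@[simp] theorem inr_mem_tensorRep {f : M → Set α} {g : N → Set β} {p : M × N} {b : β} :
    toLex (.inr b) ∈ tensorRep f g p ↔ b ∈ g p.2 := Iff.rfl

theorem lexSum_forall {p : α ⊕ₗ β → Prop} :
    (∀ z, p z) ↔ (∀ a, p (toLex (.inl a))) ∧ ∀ b, p (toLex (.inr b)) :=
  ⟨fun h => ⟨fun _ => h _, fun _ => h _⟩, fun h z => match z with
    | .inl a => h.1 a
    | .inr b => h.2 b⟩

theorem lexSum_exists {p : α ⊕ₗ β → Prop} :
    (∃ z, p z) ↔ (∃ a, p (toLex (.inl a))) ∨ ∃ b, p (toLex (.inr b)) := by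
  simp

theorem tensorRep_eq_iff {f : M → Set α} {g : N → Set β} {p q : M × N} :
    tensorRep f g p = tensorRep f g q ↔ f p.1 = f q.1 ∧ g p.2 = g q.2 := by
  simp [Set.ext_iff]

end LexSum

section Rectangles

theorem IsSlot.snoc {M : Type} {n : ℕ} (i : Fin (n + 1)) : IsSlot fun w : Fin n ⊕ Unit → M =>
    (Fin.snoc (fun j => w (.inl j)) (w (.inr ())) : Fin (n + 1) → M) i := by
  refine Fin.lastCases ?_ (fun i => ?_) i
  · simpa using IsSlot.var (Sum.inr ())
  · simpa using IsSlot.var (Sum.inl i)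

variable {M N : Type} [Lmso.Structure M] [Lmso.Structure N] {n : ℕ}

theorem Dfb.ex_snoc {S : (Fin (n + 1) → M) → Prop} (hS : Dfb S) :
    Dfb fun v : Fin n → M => ∃ x, S (Fin.snoc v x) :=
  Dfb.ex (S := fun v x => S (Fin.snoc v x)) (hS.subst fun i => IsSlot.snoc i)

/-- A relation on the product which is a finite union of products of definable relations. -/
def Rect {V : Type} (S : (V → M × N) → Prop) : Prop :=
  ∃ (ι : Type) (_ : Finite ι) (A : ι → (V → M) → Prop) (B : ι → (V → N) → Prop),
    (∀ i, Dfb (A i)) ∧ (∀ i, Dfb (B i)) ∧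
    ∀ v, S v ↔ ∃ i, A i (fun j => (v j).1) ∧ B i fun j => (v j).2

namespace Rect

variable {V : Type} {S T : (V → M × N) → Prop}

theorem congr (hS : Rect S) (h : ∀ v, T v ↔ S v) : Rect T := by
  obtain rfl : S = T := funext fun v => propext (h v).symm
  exact hS

theorem prod {A : (V → M) → Prop} {B : (V → N) → Prop} (hA : Dfb A) (hB : Dfb B) :
    Rect fun v => A (fun j => (v j).1) ∧ B fun j => (v j).2 :=
  ⟨Unit, inferInstance, fun _ => A, fun _ => B, fun _ => hA, fun _ => hB, fun v => by simp⟩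

theorem or (hS : Rect S) (hT : Rect T) : Rect fun v => S v ∨ T v := by
  obtain ⟨ι, _, A, B, hA, hB, h⟩ := hS
  obtain ⟨κ, _, C, D, hC, hD, h'⟩ := hT
  exact ⟨ι ⊕ κ, inferInstance, Sum.elim A C, Sum.elim B D, by simp [hA, hC], by simp [hB, hD],
    fun v => by simp [h, h']⟩

theorem not (hS : Rect S) : Rect fun v => ¬ S v := by
  obtain ⟨ι, _, A, B, hA, hB, h⟩ := hS
  refine ⟨Set ι, inferInstance, fun s v => ∀ i, i ∈ s → ¬ A i v, fun s v => ∀ i, i ∉ s → ¬ B i v,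
    fun s => .finite_all fun i => .imp (.const _) (hA i).not,
    fun s => .finite_all fun i => .imp (.const _) (hB i).not, fun v => ?_⟩
  simp only [h, not_exists, not_and]
  constructor
  · intro h
    exact ⟨{i | ¬ A i fun j => (v j).1}, fun i hi => hi, fun i hi => h i (not_not.1 hi)⟩
  · rintro ⟨s, hs, hs'⟩ i hA
    exact hs' i fun hi => hs i hi hA

theorem imp (hS : Rect S) (hT : Rect T) : Rect fun v => S v → T v :=
  (hS.not.or hT).congr fun _ => imp_iff_not_or

theorem ex {S : (Fin (n + 1) → M × N) → Prop} (hS : Rect S) :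
    Rect fun v => ∃ x, S (Fin.snoc v x) := by
  obtain ⟨ι, _, A, B, hA, hB, h⟩ := hS
  refine ⟨ι, inferInstance, fun i v => ∃ x, A i (Fin.snoc v x), fun i v => ∃ x, B i (Fin.snoc v x),
    fun i => (hA i).ex_snoc, fun i => (hB i).ex_snoc, fun v => ?_⟩
  have h₁ (p : M × N) : (fun j => ((Fin.snoc v p : Fin (n + 1) → M × N) j).1) =
      Fin.snoc (fun j => (v j).1) p.1 := by
    funext j
    refine Fin.lastCases ?_ (fun j => ?_) j <;> simp
  have h₂ (p : M × N) : (fun j => ((Fin.snoc v p : Fin (n + 1) → M × N) j).2) =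
      Fin.snoc (fun j => (v j).2) p.2 := by
    funext j
    refine Fin.lastCases ?_ (fun j => ?_) j <;> simp
  simp only [h, h₁, h₂, Prod.exists]
  constructor
  · rintro ⟨x, y, i, hx, hy⟩
    exact ⟨i, ⟨x, hx⟩, y, hy⟩
  · rintro ⟨i, ⟨x, hx⟩, y, hy⟩
    exact ⟨x, y, i, hx, hy⟩

theorem all {S : (Fin (n + 1) → M × N) → Prop} (hS : Rect S) :
    Rect fun v => ∀ x, S (Fin.snoc v x) :=
  hS.not.ex.not.congr fun v => by simp

end Rect

theorem tensor_bot : botE (M × N) = (botE M, botE N) := rfl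

theorem tensor_sub {p q : M × N} : subE p q ↔ subE p.1 q.1 ∧ subE p.2 q.2 := Iff.rfl

theorem tensor_exle {p q : M × N} : exleE p q ↔
    (p.1 ≠ botE M ∧ q.2 ≠ botE N) ∨ exleE p.1 q.1 ∨ exleE p.2 q.2 := Iff.rfl

theorem tensor_at {p : M × N} : atE p ↔ p ≠ (botE M, botE N) ∧
    ∀ q : M × N, subE q.1 p.1 → subE q.2 p.2 → q = (botE M, botE N) ∨ q = p := Iff.rfl

theorem tensor_term (t : Lmso.Term (Empty ⊕ Fin n)) :
    ∃ (g : (Fin n → M) → M) (h : (Fin n → N) → N), IsSlot g ∧ IsSlot h ∧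
      ∀ v : Fin n → M × N, t.realize (Sum.elim default v) =
        (g fun j => (v j).1, h fun j => (v j).2) := by
  rcases t with (i | i) | ⟨f, ts⟩
  · exact i.elim
  · exact ⟨_, _, .var i, .var i, fun v => rfl⟩
  · rename_i l
    rcases l with _ | l
    · exact ⟨_, _, .const (botE M), .const (botE N), fun v => rfl⟩
    · exact f.elim

variable {α β : Type} [LinearOrder α] [LinearOrder β] {f : M → Set α} {g : N → Set β}

theorem tensor_at_iff (hf : Rep f) (hg : Rep g) {p : M × N} : atE p ↔
    (atE p.1 ∧ p.2 = botE N) ∨ (p.1 = botE M ∧ atE p.2) := by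
  obtain ⟨x, y⟩ := p
  simp only [tensor_at, ne_eq, Prod.mk.injEq, hf.atE_iff, hg.atE_iff, Prod.forall]
  constructor
  · rintro ⟨hne, h⟩
    by_cases hx : x = botE M
    · obtain ⟨b, hb⟩ : (g y).Nonempty := by
        rw [Set.nonempty_iff_ne_empty, ne_eq, ← hg.eq_bot_iff]
        exact fun hy => hne ⟨hx, hy⟩
      rcases h (botE M) (hg.single b) (by simp [hf.sub, hf.bot]) (by simpa using hb) with h | h
      · simp [hg.eq_bot_iff, hg.apply_single] at h
      · exact .inr ⟨hx, b, h.2.symm⟩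
    · obtain ⟨a, ha⟩ : (f x).Nonempty := by
        rwa [Set.nonempty_iff_ne_empty, ne_eq, ← hf.eq_bot_iff]
      rcases h (hf.single a) (botE N) (by simpa using ha) (by simp [hg.sub, hg.bot]) with h | h
      · simp [hf.eq_bot_iff, hf.apply_single] at h
      · exact .inl ⟨⟨a, h.1.symm⟩, h.2.symm⟩
  · rintro (⟨⟨a, rfl⟩, rfl⟩ | ⟨rfl, b, rfl⟩)
    · simp only [hf.eq_bot_iff, hg.eq_bot_iff, hf.sub, hg.sub, hg.bot, ← hf.inj.eq_iff,
        hf.apply_single, Set.subset_empty_iff, Set.subset_singleton_iff_eq]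
      simp
      tauto
    · simp only [hf.eq_bot_iff, hg.eq_bot_iff, hf.sub, hg.sub, hf.bot, ← hg.inj.eq_iff,
        hg.apply_single, Set.subset_empty_iff, Set.subset_singleton_iff_eq]
      simp
      tauto

/-- Every formula over the product of two represented structures defines a finite union of
products of definable relations. -/
theorem rect_realize (hf : Rep f) (hg : Rep g) {n : ℕ} (η : BF n) :
    Rect fun v : Fin n → M × N => η.Realize default v := by
  induction η with
  | falsum =>
    exact (Rect.prod (.const False) (.const False)).congr fun v => by rw [and_self]; rfl
  | equal t s =>
    obtain ⟨g₁, h₁, hg₁, hh₁, ht⟩ := tensor_term (M := M) (N := N) t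
    obtain ⟨g₂, h₂, hg₂, hh₂, hs⟩ := tensor_term (M := M) (N := N) s
    exact (Rect.prod (.eq hg₁ hg₂) (.eq hh₁ hh₂)).congr fun v => by
      simp [BoundedFormula.Realize, ht, hs]
  | @rel m l R ts =>
    choose g h hg' hh' ht using fun i => tensor_term (M := M) (N := N) (ts i)
    rcases l with _ | _ | _ | l
    · exact R.elim
    · refine (Rect.or (Rect.prod (.atom (hg' 0)) (.eq (hh' 0) (.const (botE N))))
        (Rect.prod (.eq (hg' 0) (.const (botE M))) (.atom (hh' 0)))).congr fun v => ?_
      refine .trans ?_ ((tensor_at_iff hf hg (p := (ts 0).realize (Sum.elim default v))).trans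
        (by rw [ht 0]))
      rfl
    · cases R
      · refine (Rect.or (Rect.prod (Dfb.eq (hg' 0) (.const (botE M))).not
          (Dfb.eq (hh' 1) (.const (botE N))).not)
          (Rect.or (Rect.prod (.exle (hg' 0) (hg' 1)) (.const True))
            (Rect.prod (.const True) (.exle (hh' 0) (hh' 1))))).congr fun v => ?_
        refine .trans ?_ (tensor_exle (p := (ts 0).realize (Sum.elim default v))
          (q := (ts 1).realize (Sum.elim default v)) |>.trans (by simp [ht]))
        rfl
      · refine (Rect.prod (.sub (hg' 0) (hg' 1)) (.sub (hh' 0) (hh' 1))).congr fun v => ?_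
        refine .trans ?_ (tensor_sub (p := (ts 0).realize (Sum.elim default v))
          (q := (ts 1).realize (Sum.elim default v)) |>.trans (by simp [ht]))
        rfl
    · exact R.elim
  | imp _ _ ih₁ ih₂ => exact (ih₁.imp ih₂).congr fun v => by simp
  | all _ ih => exact ih.all.congr fun v => by simp

theorem tensorRep_inl (hf : Rep f) (hg : Rep g) (a : α) :
    tensorRep f g (hf.single a, botE N) = {toLex (.inl a)} := by
  simp [Set.ext_iff, hf.apply_single, hg.bot]

theorem tensorRep_inr (hf : Rep f) (hg : Rep g) (b : β) :
    tensorRep f g (botE M, hg.single b) = {toLex (.inr b)} := by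
  simp [Set.ext_iff, hg.apply_single, hf.bot]

theorem Rep.tensor (hf : Rep f) (hg : Rep g) : Rep (tensorRep f g) := by
  have inj : Function.Injective (tensorRep f g) := fun p q h => by
    rw [tensorRep_eq_iff] at h
    exact Prod.ext (hf.inj h.1) (hg.inj h.2)
  refine ⟨inj, fun p q => ?_, ?_, fun p => ?_, fun p q => ?_, ?_, fun n η Y => ?_⟩
  · rw [tensor_sub, hf.sub, hg.sub]
    simp [Set.subset_def]
  · simp [Set.ext_iff, tensor_bot, hf.bot, hg.bot]
  · rw [tensor_at_iff hf hg, lexSum_exists]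
    simp only [← tensorRep_inl hf hg, ← tensorRep_inr hf hg, inj.eq_iff, hf.atE_iff, hg.atE_iff,
      Prod.ext_iff, exists_and_right, exists_and_left]
  · rw [tensor_exle, hf.exle, hg.exle, ne_eq, ne_eq, hf.eq_bot_iff, hg.eq_bot_iff,
      ← ne_eq, ← ne_eq, ← Set.nonempty_iff_ne_empty, ← Set.nonempty_iff_ne_empty]
    simp only [lexSum_exists, inl_mem_tensorRep, inr_mem_tensorRep, Sum.Lex.inl_lt_inl_iff,
      Sum.Lex.inr_lt_inr_iff, Sum.Lex.inl_lt_inr, Sum.Lex.not_inr_lt_inl, and_true, and_false,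
      exists_false, false_or, Set.Nonempty]
    simp only [and_or_left, exists_or, exists_and_right]
    rw [or_left_comm, or_assoc]
  · exact lexSum_forall.2 ⟨fun a => ⟨_, tensorRep_inl hf hg a⟩, fun b => ⟨_, tensorRep_inr hf hg b⟩⟩
  · obtain ⟨ι, _, A, B, hA, hB, h⟩ := rect_realize hf hg η
    let Y₁ : Fin n → M := fun j => (Y j).1
    let Y₂ : Fin n → N := fun j => (Y j).2
    have key (x : M) (y : N) : η.Realize default (Fin.snoc Y (x, y) : Fin (n + 1) → M × N) ↔
        ∃ i, A i (Fin.snoc Y₁ x) ∧ B i (Fin.snoc Y₂ y) := by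
      refine (h _).trans ?_
      refine exists_congr fun i => and_congr (iff_of_eq (congrArg _ (funext fun j => ?_)))
        (iff_of_eq (congrArg _ (funext fun j => ?_))) <;>
      refine Fin.lastCases ?_ (fun j => ?_) j <;> simp [Y₁, Y₂]
    obtain ⟨X₁, hX₁⟩ := hf.exists_of_dfb
      (S := fun x => ∃ i, A i (Fin.snoc Y₁ x) ∧ B i (Fin.snoc Y₂ (botE N)))
      (.finite_ex fun i => .and ((hA i).subst (g := fun j w => (Fin.snoc Y₁ (w ()) :
        Fin (n + 1) → M) j) fun j => by
          refine Fin.lastCases ?_ (fun j => ?_) j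
          · simpa using .var _
          · simpa using .const _) (.const _))
    obtain ⟨X₂, hX₂⟩ := hg.exists_of_dfb
      (S := fun y => ∃ i, A i (Fin.snoc Y₁ (botE M)) ∧ B i (Fin.snoc Y₂ y))
      (.finite_ex fun i => .and (.const _) ((hB i).subst (g := fun j w => (Fin.snoc Y₂ (w ()) :
        Fin (n + 1) → N) j) fun j => by
          refine Fin.lastCases ?_ (fun j => ?_) j
          · simpa using .var _
          · simpa using .const _))
    refine ⟨(X₁, X₂), fun ⟨x, y⟩ hp => ?_⟩
    rw [key, tensor_sub]
    rcases (tensor_at_iff hf hg).1 hp with ⟨hx, rfl : y = _⟩ | ⟨rfl : x = _, hy⟩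
    · obtain ⟨a, rfl⟩ := hf.atE_iff.1 hx
      rw [← hX₁ a _ (hf.apply_single a)]
      simp [hg.sub, hg.bot]
    · obtain ⟨b, rfl⟩ := hg.atE_iff.1 hy
      rw [← hX₂ b _ (hg.apply_single b)]
      simp [hf.sub, hf.bot]

end Rectangles

section LexSumOrder

variable {α β : Type} [LinearOrder α] [LinearOrder β]

theorem lexSum_inl_covBy_inl {a a' : α} :
    (toLex (.inl a) : α ⊕ₗ β) ⋖ toLex (.inl a') ↔ a ⋖ a' := by
  simp [CovBy]

theorem lexSum_inr_covBy_inr {b b' : β} :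
    (toLex (.inr b) : α ⊕ₗ β) ⋖ toLex (.inr b') ↔ b ⋖ b' := by
  simp [CovBy]

theorem lexSum_inl_covBy_inr {a : α} {b : β} :
    (toLex (.inl a) : α ⊕ₗ β) ⋖ toLex (.inr b) ↔ IsTop a ∧ IsBot b := by
  simp [CovBy, IsTop, IsBot]

theorem lexSum_isBot_inl {a : α} (ha : IsBot a) : IsBot (toLex (.inl a) : α ⊕ₗ β) := by
  simpa [IsBot] using ha

theorem lexSum_isTop_inr {b : β} (hb : IsTop b) : IsTop (toLex (.inr b) : α ⊕ₗ β) := by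
  simpa [IsTop] using hb

end LexSumOrder

theorem Good.tensor {M N α β : Type} [LinearOrder α] [LinearOrder β] {f : M → Set α}
    {g : N → Set β} {r₁ r₂ : ℕ → ℕ} (hf : Good r₁ f) (hg : Good r₂ g) :
    Good (fun d => (r₁ d + r₂ d) % d) (tensorRep f g) := by
  obtain ⟨a₀, ha₀⟩ := hf.bot
  obtain ⟨a₁, ha₁⟩ := hf.top
  obtain ⟨b₀, hb₀⟩ := hg.bot
  obtain ⟨b₁, hb₁⟩ := hg.top
  have := hf.infinite
  refine ⟨.of_injective (fun a : α => (toLex (.inl a) : α ⊕ₗ β)) fun a a' h => by simpa using h,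
    ⟨_, lexSum_isBot_inl ha₀⟩, ⟨_, lexSum_isTop_inr hb₁⟩, ?_, ?_, ?_, fun d hd => ?_⟩
  · rw [lexSum_forall]
    constructor
    · intro a _ _
      by_cases h : ∃ a', a < a'
      · obtain ⟨a', h⟩ := h
        obtain ⟨c, hc⟩ := hf.succ a a' h
        exact ⟨_, lexSum_inl_covBy_inl.2 hc⟩
      · exact ⟨_, lexSum_inl_covBy_inr.2 ⟨by simpa [IsTop] using h, hb₀⟩⟩
    · refine fun b => lexSum_forall.2 ⟨fun a h => by simp at h, fun b' h => ?_⟩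
      obtain ⟨c, hc⟩ := hg.succ b b' (by simpa using h)
      exact ⟨_, lexSum_inr_covBy_inr.2 hc⟩
  · rw [lexSum_forall]
    constructor
    · refine fun a => lexSum_forall.2 ⟨fun a' h => ?_, fun b h => by simp at h⟩
      obtain ⟨c, hc⟩ := hf.pred a a' (by simpa using h)
      exact ⟨_, lexSum_inl_covBy_inl.2 hc⟩
    · intro b _ _
      by_cases h : ∃ b', b' < b
      · obtain ⟨b', h⟩ := h
        obtain ⟨c, hc⟩ := hg.pred b b' h
        exact ⟨_, lexSum_inr_covBy_inr.2 hc⟩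
      · exact ⟨_, lexSum_inl_covBy_inr.2 ⟨ha₁, by simpa [IsBot] using h⟩⟩
  · intro p hp
    by_cases h : (f p.1).Nonempty
    · obtain ⟨a, ha, hmin⟩ := hf.min _ h
      refine ⟨toLex (.inl a), ha, lexSum_forall.2 ⟨fun a' h' => ?_, fun b _ => by simp⟩⟩
      simpa using hmin h'
    · rw [Set.not_nonempty_iff_eq_empty] at h
      obtain ⟨b, hb, hmin⟩ := hg.min p.2 (by
        simpa [Set.Nonempty, lexSum_exists, h] using hp)
      refine ⟨toLex (.inr b), hb, lexSum_forall.2 ⟨fun a' h' => ?_, fun b' h' => ?_⟩⟩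
      · simp [h] at h'
      · simpa using hmin h'
  · obtain ⟨c₁, hc₁, hbot₁, hsucc₁, htop₁⟩ := hf.color d hd
    obtain ⟨c₂, hc₂, hbot₂, hsucc₂, htop₂⟩ := hg.color d hd
    refine ⟨fun z => Sum.elim c₁ (fun b => c₂ b + r₁ d) (ofLex z), fun i => ?_, ?_, ?_, ?_⟩
    · obtain ⟨x, hx⟩ := hc₁ i
      obtain ⟨y, hy⟩ := hc₂ (i - r₁ d)
      refine ⟨(x, y), Set.ext (lexSum_forall.2 ⟨fun a => ?_, fun b => ?_⟩)⟩
      · simp [hx]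
      · simp [hy, eq_sub_iff_add_eq]
    · intro z hz
      obtain rfl : z = toLex (.inl a₀) := le_antisymm (hz _) (lexSum_isBot_inl ha₀ z)
      simp [hbot₁ a₀ ha₀]
    · simp only [lexSum_forall, lexSum_inl_covBy_inl, lexSum_inl_covBy_inr, lexSum_inr_covBy_inr]
      refine ⟨fun a => ⟨fun a' h => ?_, fun b h => ?_⟩, fun b => ⟨fun a h => ?_, fun b' h => ?_⟩⟩
      · simpa using hsucc₁ a a' h
      · simp [htop₁ a h.1, hbot₂ b h.2]
      · simpa using h.1
      · simp [hsucc₂ b b' h, add_right_comm]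
    · intro z hz
      obtain rfl : z = toLex (.inr b₁) := le_antisymm (lexSum_isTop_inr hb₁ z) (hz _)
      simp [htop₂ b₁ hb₁]
      ring

/-- Quantifier-free types of `n`-tuples of sets. -/
def Diagram (n : ℕ) : Type :=
  (Fin n → Prop) × (Fin n → Prop) × (Fin n → Fin n → Prop) × (Fin n → Fin n → Prop)

instance (n : ℕ) : Finite (Diagram n) := by
  unfold Diagram
  infer_instance

/-- The quantifier-free type of a tuple of sets: which of them are empty, which of them are
singletons, and the relations `⊆` and `≤ᴱ` between them. -/
def diagram {α : Type} [LinearOrder α] {n : ℕ} (s : Fin n → Set α) : Diagram n :=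
  (fun i => s i = ∅, fun i => ∃ a, s i = {a}, fun i j => s i ⊆ s j,
    fun i j => ∃ a ∈ s i, ∃ b ∈ s j, a < b)

/-- Types of quantifier rank `k` of `n`-tuples. -/
def RankType : ℕ → ℕ → Type
  | 0, n => Diagram n
  | k + 1, n => Set (RankType k (n + 1))

instance RankType.finite : ∀ k n, Finite (RankType k n)
  | 0, n => inferInstanceAs (Finite (Diagram n))
  | k + 1, n => by
    have := RankType.finite k (n + 1)
    exact inferInstanceAs (Finite (Set (RankType k (n + 1))))

/-- The type of quantifier rank `k` of the traces on `u` of a tuple. -/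
def rankType {P α : Type} [LinearOrder α] (f : P → Set α) (u : Set α) :
    ∀ (k : ℕ) {n : ℕ}, (Fin n → P) → RankType k n
  | 0, _, a => diagram fun i => f (a i) ∩ u
  | k + 1, n, a => Set.range fun x => (rankType f u k (Fin.snoc a x : Fin (n + 1) → P))

section Diagram

variable {α β : Type} [LinearOrder α] [LinearOrder β] {n : ℕ}

theorem diagram_eq_iff {s : Fin n → Set α} {t : Diagram n} : diagram s = t ↔
    (∀ i, s i = ∅ ↔ t.1 i) ∧ (∀ i, (∃ a, s i = {a}) ↔ t.2.1 i) ∧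
    (∀ i j, s i ⊆ s j ↔ t.2.2.1 i j) ∧
    ∀ i j, (∃ a ∈ s i, ∃ b ∈ s j, a < b) ↔ t.2.2.2 i j := by
  obtain ⟨t₁, t₂, t₃, t₄⟩ := t
  constructor
  · intro h
    obtain ⟨rfl, rfl, rfl, rfl⟩ := by simpa [diagram] using h
    simp
  · rintro ⟨h₁, h₂, h₃, h₄⟩
    exact Prod.ext (funext fun i => propext (h₁ i)) (Prod.ext (funext fun i => propext (h₂ i))
      (Prod.ext (funext fun i => funext fun j => propext (h₃ i j))
        (funext fun i => funext fun j => propext (h₄ i j))))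

theorem diagram_eq_diagram_iff {s : Fin n → Set α} {t : Fin n → Set β} :
    diagram s = diagram t ↔
    (∀ i, s i = ∅ ↔ t i = ∅) ∧ (∀ i, (∃ a, s i = {a}) ↔ ∃ a, t i = {a}) ∧
    (∀ i j, s i ⊆ s j ↔ t i ⊆ t j) ∧
    ∀ i j, (∃ a ∈ s i, ∃ b ∈ s j, a < b) ↔ ∃ a ∈ t i, ∃ b ∈ t j, a < b :=
  diagram_eq_iff

theorem union_eq_singleton_iff {s t : Set α} (h : ∀ a ∈ s, ∀ b ∈ t, a < b) :
    (∃ a, s ∪ t = {a}) ↔ ((∃ a, s = {a}) ∧ t = ∅) ∨ (s = ∅ ∧ ∃ a, t = {a}) := by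
  constructor
  · rintro ⟨a, ha⟩
    have hs : s ⊆ {a} := ha ▸ Set.subset_union_left
    have ht : t ⊆ {a} := ha ▸ Set.subset_union_right
    rcases Set.subset_singleton_iff_eq.1 hs with rfl | rfl
    · exact .inr ⟨rfl, a, by simpa using ha⟩
    · rcases Set.subset_singleton_iff_eq.1 ht with rfl | rfl
      · exact .inl ⟨⟨a, rfl⟩, rfl⟩
      · exact (lt_irrefl a (h a rfl a rfl)).elim
  · rintro (⟨⟨a, rfl⟩, rfl⟩ | ⟨rfl, a, rfl⟩) <;> exact ⟨a, by simp⟩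

theorem union_subset_union_iff {s t s' t' v w : Set α} (h : ∀ a ∈ v, ∀ b ∈ w, a < b)
    (hs : s ⊆ v) (ht : t ⊆ w) (hs' : s' ⊆ v) (ht' : t' ⊆ w) :
    s ∪ t ⊆ s' ∪ t' ↔ s ⊆ s' ∧ t ⊆ t' := by
  refine ⟨fun hu => ⟨fun a ha => ?_, fun a ha => ?_⟩, fun hu => Set.union_subset_union hu.1 hu.2⟩
  · exact (hu (.inl ha)).resolve_right fun h' => lt_irrefl a (h a (hs ha) a (ht' h'))
  · exact (hu (.inr ha)).resolve_left fun h' => lt_irrefl a (h a (hs' h') a (ht ha))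

theorem exists_union_lt_iff {s t s' t' v w : Set α} (h : ∀ a ∈ v, ∀ b ∈ w, a < b)
    (hs : s ⊆ v) (ht : t ⊆ w) (hs' : s' ⊆ v) (ht' : t' ⊆ w) :
    (∃ a ∈ s ∪ t, ∃ b ∈ s' ∪ t', a < b) ↔ (∃ a ∈ s, ∃ b ∈ s', a < b) ∨
      (∃ a ∈ t, ∃ b ∈ t', a < b) ∨ (s ≠ ∅ ∧ t' ≠ ∅) := by
  simp only [ne_eq, ← Set.not_nonempty_iff_eq_empty, not_not]
  constructor
  · rintro ⟨a, ha | ha, b, hb | hb, hab⟩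
    · exact .inl ⟨a, ha, b, hb, hab⟩
    · exact .inr (.inr ⟨⟨a, ha⟩, b, hb⟩)
    · exact (lt_asymm hab (h b (hs' hb) a (ht ha))).elim
    · exact .inr (.inl ⟨a, ha, b, hb, hab⟩)
  · rintro (⟨a, ha, b, hb, hab⟩ | ⟨a, ha, b, hb, hab⟩ | ⟨⟨a, ha⟩, b, hb⟩)
    · exact ⟨a, .inl ha, b, .inl hb, hab⟩
    · exact ⟨a, .inr ha, b, .inr hb, hab⟩
    · exact ⟨a, .inl ha, b, .inr hb, h a (hs ha) b (ht' hb)⟩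

theorem diagram_union {s t : Fin n → Set α} {s' t' : Fin n → Set β} {v w : Set α} {v' w' : Set β}
    (h : ∀ a ∈ v, ∀ b ∈ w, a < b) (h' : ∀ a ∈ v', ∀ b ∈ w', a < b)
    (hs : ∀ i, s i ⊆ v) (ht : ∀ i, t i ⊆ w) (hs' : ∀ i, s' i ⊆ v') (ht' : ∀ i, t' i ⊆ w')
    (h₁ : diagram s = diagram s') (h₂ : diagram t = diagram t') :
    diagram (fun i => s i ∪ t i) = diagram fun i => s' i ∪ t' i := by
  rw [diagram_eq_diagram_iff] at h₁ h₂ ⊢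
  refine ⟨fun i => ?_, fun i => ?_, fun i j => ?_, fun i j => ?_⟩
  · rw [Set.union_empty_iff, Set.union_empty_iff, h₁.1, h₂.1]
  · rw [union_eq_singleton_iff fun a ha b hb => h a (hs i ha) b (ht i hb),
      union_eq_singleton_iff fun a ha b hb => h' a (hs' i ha) b (ht' i hb), h₁.1, h₂.1, h₁.2.1,
      h₂.2.1]
  · rw [union_subset_union_iff h (hs i) (ht i) (hs j) (ht j),
      union_subset_union_iff h' (hs' i) (ht' i) (hs' j) (ht' j), h₁.2.2.1, h₂.2.2.1]
  · rw [exists_union_lt_iff h (hs i) (ht i) (hs j) (ht j),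
      exists_union_lt_iff h' (hs' i) (ht' i) (hs' j) (ht' j), h₁.2.2.2, h₂.2.2.2, ne_eq, ne_eq,
      h₁.1, h₂.1]

end Diagram

section RankType

theorem exists_mem_iff {Q β : Type} {g : Q → Set β} (hg₀ : ∃ y, g y = ∅)
    (hg₁ : ∃ y, g y = Set.univ) (p : Prop) (q : β) : ∃ y, p ↔ q ∈ g y := by
  by_cases hp : p
  · exact hg₁.imp fun y hy => by simp [hy, hp]
  · exact hg₀.imp fun y hy => by simp [hy, hp]

variable {P Q α β : Type} [LinearOrder α] [LinearOrder β] {f : P → Set α} {g : Q → Set β}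
  {u v w : Set α} {u' v' w' : Set β}

theorem rankType_congr (k : ℕ) {n : ℕ} {a b : Fin n → P} (h : ∀ i, f (a i) ∩ u = f (b i) ∩ u) :
    rankType f u k a = rankType f u k b := by
  induction k generalizing n with
  | zero => exact congrArg diagram (funext h)
  | succ k ih =>
    refine congrArg Set.range (funext fun x => ih fun i => ?_)
    refine Fin.lastCases ?_ (fun i => ?_) i
    · simp
    · simpa using h i

theorem rankType_succ_eq_of_forall {k n : ℕ} {a : Fin n → P} {b : Fin n → Q}
    (h₁ : ∀ x, ∃ y, rankType f u k (Fin.snoc a x : Fin (n + 1) → P) =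
      rankType g u' k (Fin.snoc b y : Fin (n + 1) → Q))
    (h₂ : ∀ y, ∃ x, rankType g u' k (Fin.snoc b y : Fin (n + 1) → Q) =
      rankType f u k (Fin.snoc a x : Fin (n + 1) → P)) :
    rankType f u (k + 1) a = rankType g u' (k + 1) b := by
  refine Set.Subset.antisymm ?_ ?_
  · rintro _ ⟨x, rfl⟩
    obtain ⟨y, hy⟩ := h₁ x
    exact ⟨y, hy.symm⟩
  · rintro _ ⟨y, rfl⟩
    obtain ⟨x, hx⟩ := h₂ y
    exact ⟨x, hx.symm⟩

theorem exists_rankType_eq {k n : ℕ} {a : Fin n → P} {b : Fin n → Q}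
    (h : rankType f u (k + 1) a = rankType g u' (k + 1) b) (x : P) :
    ∃ y, rankType f u k (Fin.snoc a x : Fin (n + 1) → P) =
      rankType g u' k (Fin.snoc b y : Fin (n + 1) → Q) := by
  obtain ⟨y, hy⟩ := (show Set.range _ = Set.range _ from h).subset (Set.mem_range_self x)
  exact ⟨y, hy.symm⟩

theorem diagram_eq_of_rankType_eq [Nonempty P] (k : ℕ) {n : ℕ} {a : Fin n → P} {b : Fin n → Q}
    (h : rankType f u k a = rankType g u' k b) :
    diagram (fun i => f (a i) ∩ u) = diagram fun i => g (b i) ∩ u' := by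
  induction k generalizing n with
  | zero => exact h
  | succ k ih =>
    obtain ⟨y, hy⟩ := exists_rankType_eq h (Classical.arbitrary P)
    have := diagram_eq_diagram_iff.1 (ih hy)
    refine diagram_eq_diagram_iff.2 ⟨fun i => ?_, fun i => ?_, fun i j => ?_, fun i j => ?_⟩
    · simpa using this.1 i.castSucc
    · simpa using this.2.1 i.castSucc
    · simpa using this.2.2.1 i.castSucc j.castSucc
    · simpa using this.2.2.2 i.castSucc j.castSucc

/-- Two families of sets are glued along a decomposition of the order. -/
def Gluing (f : P → Set α) (v w : Set α) : Prop :=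
  (∀ a ∈ v, ∀ b ∈ w, a < b) ∧ ∀ x y, ∃ z, f z = (f x ∩ v) ∪ (f y ∩ w)

theorem Gluing.exists_rankType_eq (hg : Gluing g v' w') {k n : ℕ}
    {a : Fin n → P} {b : Fin n → Q} (h₁ : rankType f v (k + 1) a = rankType g v' (k + 1) b)
    (h₂ : rankType f w (k + 1) a = rankType g w' (k + 1) b) (x : P) : ∃ y,
    rankType f v k (Fin.snoc a x : Fin (n + 1) → P) =
      rankType g v' k (Fin.snoc b y : Fin (n + 1) → Q) ∧
    rankType f w k (Fin.snoc a x : Fin (n + 1) → P) =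
      rankType g w' k (Fin.snoc b y : Fin (n + 1) → Q) := by
  obtain ⟨y₁, hy₁⟩ := MSO.exists_rankType_eq h₁ x
  obtain ⟨y₂, hy₂⟩ := MSO.exists_rankType_eq h₂ x
  obtain ⟨y, hy⟩ := hg.2 y₁ y₂
  have disj (c : β) (hv : c ∈ v') (hw : c ∈ w') : False := lt_irrefl c (hg.1 c hv c hw)
  refine ⟨y, hy₁.trans (rankType_congr k fun i => ?_), hy₂.trans (rankType_congr k fun i => ?_)⟩
  · refine Fin.lastCases ?_ (fun i => ?_) i
    · ext c
      have := disj c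
      simp only [Fin.snoc_last, hy, Set.mem_inter_iff, Set.mem_union]
      tauto
    · simp
  · refine Fin.lastCases ?_ (fun i => ?_) i
    · ext c
      have := disj c
      simp only [Fin.snoc_last, hy, Set.mem_inter_iff, Set.mem_union]
      tauto
    · simp

/-- The composition theorem: types over a decomposed set are determined by the types over
the two parts. -/
theorem rankType_union (hf : Gluing f v w) (hg : Gluing g v' w') (k : ℕ) {n : ℕ}
    {a : Fin n → P} {b : Fin n → Q} (h₁ : rankType f v k a = rankType g v' k b)
    (h₂ : rankType f w k a = rankType g w' k b) :
    rankType f (v ∪ w) k a = rankType g (v' ∪ w') k b := by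
  induction k generalizing n with
  | zero =>
    simp only [rankType, Set.inter_union_distrib_left]
    exact diagram_union hf.1 hg.1 (fun _ => Set.inter_subset_right)
      (fun _ => Set.inter_subset_right) (fun _ => Set.inter_subset_right)
      (fun _ => Set.inter_subset_right) h₁ h₂
  | succ k ih =>
    refine rankType_succ_eq_of_forall (fun x => ?_) fun y => ?_
    · obtain ⟨y, hy₁, hy₂⟩ := hg.exists_rankType_eq h₁ h₂ x
      exact ⟨y, ih hy₁ hy₂⟩
    · obtain ⟨x, hx₁, hx₂⟩ := hf.exists_rankType_eq h₁.symm h₂.symm y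
      exact ⟨x, (ih hx₁.symm hx₂.symm).symm⟩

theorem rankType_singleton (hf₀ : ∃ y, f y = ∅) (hf₁ : ∃ y, f y = Set.univ)
    (hg₀ : ∃ y, g y = ∅) (hg₁ : ∃ y, g y = Set.univ) (k : ℕ) {n : ℕ} {p : α} {q : β}
    {a : Fin n → P} {b : Fin n → Q} (h : ∀ i, p ∈ f (a i) ↔ q ∈ g (b i)) :
    rankType f {p} k a = rankType g {q} k b := by
  induction k generalizing n with
  | zero =>
    have hf' (i) : f (a i) ∩ {p} = {x | x = p ∧ p ∈ f (a i)} :=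
      Set.ext fun x => ⟨fun ⟨h, e⟩ => ⟨e, e ▸ h⟩, fun ⟨e, h⟩ => ⟨e ▸ h, e⟩⟩
    have hg' (i) : g (b i) ∩ {q} = {x | x = q ∧ p ∈ f (a i)} := by
      rw [h]
      exact Set.ext fun x => ⟨fun ⟨h, e⟩ => ⟨e, e ▸ h⟩, fun ⟨e, h⟩ => ⟨e ▸ h, e⟩⟩
    refine diagram_eq_diagram_iff.2 ?_
    simp only [hf', hg']
    refine ⟨fun i => ?_, fun i => ?_, fun i j => ?_, fun i j => ?_⟩
    · by_cases hi : p ∈ f (a i) <;> simp [hi]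
    · by_cases hi : p ∈ f (a i) <;> simp [hi]
    · by_cases hi : p ∈ f (a i) <;> by_cases hj : p ∈ f (a j) <;> simp [hi, hj]
    · by_cases hi : p ∈ f (a i) <;> by_cases hj : p ∈ f (a j) <;> simp [hi, hj]
  | succ k ih =>
    refine rankType_succ_eq_of_forall (fun x => ?_) fun y => ?_
    · obtain ⟨y, hy⟩ := exists_mem_iff hg₀ hg₁ (p ∈ f x) q
      refine ⟨y, ih fun i => ?_⟩
      refine Fin.lastCases ?_ (fun i => ?_) i
      · simpa using hy
      · simpa using h i
    · obtain ⟨x, hx⟩ := exists_mem_iff hf₀ hf₁ (q ∈ g y) p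
      refine ⟨x, (ih fun i => ?_).symm⟩
      refine Fin.lastCases ?_ (fun i => ?_) i
      · simpa using hx.symm
      · simpa using h i

end RankType

section Definability

variable {P V α : Type}

theorem IsSlot.inl {g : (V → P) → P} (hg : IsSlot g) :
    IsSlot fun w : V ⊕ Unit → P => g fun i => w (.inl i) := by
  obtain ⟨i | i, hi⟩ := hg
  · exact ⟨.inl i, fun w => hi _⟩
  · exact ⟨.inr (.inl i), fun w => hi _⟩

theorem IsSlot.inr : IsSlot fun w : V ⊕ Unit → P => w (.inr ()) := .var _

variable [Lmso.Structure P] [LinearOrder α] {f : P → Set α}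

theorem Rep.dfb_diagram (hf : Rep f) {n : ℕ} {u : (V → P) → P} {a : Fin n → (V → P) → P}
    (hu : IsSlot u) (ha : ∀ i, IsSlot (a i)) (t : Diagram n) :
    Dfb fun v => diagram (fun i => f (a i v) ∩ f (u v)) = t := by
  have mem (i : Fin n) : Dfb fun w : V ⊕ Unit → P =>
      subE (w (.inr ())) (a i fun j => w (.inl j)) ∧ subE (w (.inr ())) (u fun j => w (.inl j)) :=
    (Dfb.sub .inr (ha i).inl).and (Dfb.sub .inr hu.inl)
  have mem' (i : Fin n) : Dfb fun w : (V ⊕ Unit) ⊕ Unit → P =>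
      subE (w (.inr ())) (a i fun j => w (.inl (.inl j))) ∧
        subE (w (.inr ())) (u fun j => w (.inl (.inl j))) :=
    (Dfb.sub .inr (ha i).inl.inl).and (Dfb.sub .inr hu.inl.inl)
  have at' : Dfb fun w : V ⊕ Unit → P => atE (w (.inr ())) := .atom .inr
  have at'' : Dfb fun w : (V ⊕ Unit) ⊕ Unit → P => atE (w (.inr ())) := .atom .inr
  have empty (i : Fin n) : Dfb fun v => f (a i v) ∩ f (u v) = ∅ := by
    refine Dfb.congr (Dfb.all (S := fun v x => atE x → ¬ (subE x (a i v) ∧ subE x (u v)))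
      (at'.imp (mem i).not)) fun v => ?_
    simp [hf.forall_atE, Set.eq_empty_iff_forall_notMem]
  have single (i : Fin n) : Dfb fun v => ∃ p, f (a i v) ∩ f (u v) = {p} := by
    refine Dfb.congr (Dfb.ex (S := fun v x => atE x ∧ ∀ y, atE y →
      ((subE y (a i v) ∧ subE y (u v)) ↔ y = x)) (at'.and (Dfb.all (S := fun w y => atE y →
        ((subE y (a i fun j => w (.inl j)) ∧ subE y (u fun j => w (.inl j))) ↔ y = w (.inr ())))
        (at''.imp ((mem' i).iff (.eq .inr IsSlot.inr.inl)))))) fun v => ?_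
    simp [hf.forall_atE, hf.exists_atE, Set.ext_iff, hf.single_inj]
  have sub (i j : Fin n) : Dfb fun v => f (a i v) ∩ f (u v) ⊆ f (a j v) ∩ f (u v) := by
    refine Dfb.congr (Dfb.all (S := fun v x => atE x → (subE x (a i v) ∧ subE x (u v)) →
      (subE x (a j v) ∧ subE x (u v))) (at'.imp ((mem i).imp (mem j)))) fun v => ?_
    simp only [hf.forall_atE, hf.single_sub]
    rfl
  have exle (i j : Fin n) : Dfb fun v => ∃ p ∈ f (a i v) ∩ f (u v), ∃ q ∈ f (a j v) ∩ f (u v),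
      p < q := by
    refine Dfb.congr (Dfb.ex (S := fun v x => atE x ∧ (subE x (a i v) ∧ subE x (u v)) ∧
      ∃ y, atE y ∧ (subE y (a j v) ∧ subE y (u v)) ∧ exleE x y) (at'.and ((mem i).and
        (Dfb.ex (S := fun w y => atE y ∧ (subE y (a j fun l => w (.inl l)) ∧
          subE y (u fun l => w (.inl l))) ∧ exleE (w (.inr ())) y)
        (at''.and ((mem' j).and (.exle IsSlot.inr.inl .inr))))))) fun v => ?_
    simp only [hf.exists_atE, hf.single_sub, hf.single_exle]
    rfl
  refine Dfb.congr ((Dfb.finite_all fun i => (empty i).iff (.const (t.1 i))).and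
    ((Dfb.finite_all fun i => (single i).iff (.const (t.2.1 i))).and
    ((Dfb.finite_all fun i => .finite_all fun j => (sub i j).iff (.const (t.2.2.1 i j))).and
    (Dfb.finite_all fun i => .finite_all fun j => (exle i j).iff (.const (t.2.2.2 i j))))))
    fun v => diagram_eq_iff.symm

/-- Having a given type of quantifier rank `k` over a variable set is definable. -/
theorem Rep.dfb_rankType (hf : Rep f) (k : ℕ) {n : ℕ} {u : (V → P) → P}
    {a : Fin n → (V → P) → P} (hu : IsSlot u) (ha : ∀ i, IsSlot (a i)) (t : RankType k n) :
    Dfb fun v => rankType f (f (u v)) k (fun i => a i v) = t := by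
  induction k generalizing n V with
  | zero => exact hf.dfb_diagram hu ha t
  | succ k ih =>
    have := RankType.finite k (n + 1)
    refine Dfb.congr (Dfb.finite_all (ι := RankType k (n + 1)) fun t' =>
      (Dfb.ex (S := fun v x => rankType f (f (u v)) k
        (Fin.snoc (fun i => a i v) x : Fin (n + 1) → P) = t') ?_).iff (.const (t' ∈ show Set _ from t)))
      fun v => Set.ext_iff.symm
    refine ih (a := fun i w => (Fin.snoc (fun i => a i fun j => w (.inl j)) (w (.inr ())) :
      Fin (n + 1) → P) i) hu.inl (fun i => ?_) t'
    refine Fin.lastCases ?_ (fun i => ?_) i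
    · simpa using IsSlot.inr
    · simpa using (ha i).inl

end Definability

section Realize

variable {P Q α β : Type} [Lmso.Structure P] [Lmso.Structure Q] [LinearOrder α] [LinearOrder β]
  {f : P → Set α} {g : Q → Set β}

/-- Terms are variables or `⊥`. -/
theorem term_cases {n : ℕ} (t : Lmso.Term (Empty ⊕ Fin n)) : (∃ i, t = tv i) ∨ t = tb := by
  rcases t with (i | i) | ⟨c, ts⟩
  · exact i.elim
  · exact .inl ⟨i, rfl⟩
  · rename_i l
    match l, c with
    | 0, _ => exact .inr (congrArg (Term.func _) (Subsingleton.elim _ _))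

theorem Rep.diagram_terms (hf : Rep f) (hg : Rep g) {n m : ℕ} {a : Fin n → P} {b : Fin n → Q}
    (h : diagram (fun i => f (a i)) = diagram fun i => g (b i))
    (ts : Fin m → Lmso.Term (Empty ⊕ Fin n)) :
    diagram (fun i => f ((ts i).realize (Sum.elim default a))) =
      diagram fun i => g ((ts i).realize (Sum.elim default b)) := by
  rw [diagram_eq_diagram_iff] at h ⊢
  obtain ⟨h₁, h₂, h₃, h₄⟩ := h
  refine ⟨fun i => ?_, fun i => ?_, fun i j => ?_, fun i j => ?_⟩
  · obtain ⟨i, hi⟩ | hi := term_cases (ts i) <;> simp [hi, hf.bot, hg.bot, h₁]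
  · obtain ⟨i, hi⟩ | hi := term_cases (ts i) <;> simp [hi, hf.bot, hg.bot, h₂]
  · obtain ⟨i, hi⟩ | hi := term_cases (ts i) <;> obtain ⟨j, hj⟩ | hj := term_cases (ts j) <;>
      simp [hi, hj, hf.bot, hg.bot, h₁, h₃]
  · obtain ⟨i, hi⟩ | hi := term_cases (ts i) <;> obtain ⟨j, hj⟩ | hj := term_cases (ts j) <;>
      simp [hi, hj, hf.bot, hg.bot, h₄]

/-- Types of quantifier rank `k` determine the truth of formulas of quantifier rank `k`. -/
theorem Rep.realize_iff_of_rankType_eq (hf : Rep f) (hg : Rep g) {n : ℕ} (η : BF n) {k : ℕ}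
    (hk : qr η ≤ k) {a : Fin n → P} {b : Fin n → Q}
    (h : rankType f Set.univ k a = rankType g Set.univ k b) :
    η.Realize default a ↔ η.Realize default b := by
  induction η generalizing k with
  | falsum => rfl
  | equal t s =>
    have : Nonempty P := ⟨botE P⟩
    have h' := diagram_eq_of_rankType_eq k h
    simp only [Set.inter_univ] at h'
    have h₃ := (diagram_eq_diagram_iff.1 (hf.diagram_terms hg h' ![t, s])).2.2.1
    have h₀₁ := h₃ 0 1
    have h₁₀ := h₃ 1 0
    simp only [Matrix.cons_val_zero, Matrix.cons_val_one] at h₀₁ h₁₀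
    simp only [BoundedFormula.Realize, ← hf.inj.eq_iff, ← hg.inj.eq_iff, Set.Subset.antisymm_iff,
      h₀₁, h₁₀]
  | @rel n l R ts =>
    have : Nonempty P := ⟨botE P⟩
    have h' := diagram_eq_of_rankType_eq k h
    simp only [Set.inter_univ] at h'
    obtain ⟨-, h₂, h₃, h₄⟩ := diagram_eq_diagram_iff.1 (hf.diagram_terms hg h' ts)
    have eta {X : Type} (x : Fin 2 → X) : x = ![x 0, x 1] := by ext i; fin_cases i <;> rfl
    have eta' {X : Type} (x : Fin 1 → X) : x = ![x 0] := by ext i; fin_cases i; rfl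
    simp only [BoundedFormula.Realize]
    match l, R with
    | 1, () =>
      rw [eta' fun i => (ts i).realize (Sum.elim default a),
        eta' fun i => (ts i).realize (Sum.elim default b)]
      exact (hf.atom _).trans ((h₂ 0).trans (hg.atom _).symm)
    | 2, true =>
      rw [eta fun i => (ts i).realize (Sum.elim default a),
        eta fun i => (ts i).realize (Sum.elim default b)]
      exact (hf.sub _ _).trans ((h₃ 0 1).trans (hg.sub _ _).symm)
    | 2, false =>
      rw [eta fun i => (ts i).realize (Sum.elim default a),
        eta fun i => (ts i).realize (Sum.elim default b)]
      exact (hf.exle _ _).trans ((h₄ 0 1).trans (hg.exle _ _).symm)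
  | imp φ ψ ih₁ ih₂ =>
    simp only [qr, max_le_iff] at hk
    simp only [BoundedFormula.realize_imp, ih₁ hk.1 h, ih₂ hk.2 h]
  | all φ ih =>
    obtain _ | k := k
    · simp [qr] at hk
    simp only [qr, add_le_add_iff_right] at hk
    simp only [BoundedFormula.realize_all]
    constructor
    · intro hφ y
      obtain ⟨x, hx⟩ := exists_rankType_eq h.symm y
      exact (ih hk hx.symm).1 (hφ x)
    · intro hφ x
      obtain ⟨y, hy⟩ := exists_rankType_eq h x
      exact (ih hk hy).2 (hφ y)

end Realize

section Completeness

variable {P Q α β : Type} [LinearOrder α] [LinearOrder β] {f : P → Set α} {g : Q → Set β}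

/-- The type of quantifier rank `k` of the initial segment with greatest element `a`. -/
def initType (f : P → Set α) (k : ℕ) (a : α) : RankType k 0 :=
  rankType f (Set.Iic a) k (default : Fin 0 → P)

theorem Iic_eq_union_of_covBy {a b : α} (h : a ⋖ b) : Set.Iic b = Set.Iic a ∪ {b} := by
  ext x
  simp only [Set.mem_Iic, Set.mem_union, Set.mem_singleton_iff]
  rw [le_iff_lt_or_eq, h.lt_iff_le_left]

variable [Lmso.Structure P] [Lmso.Structure Q]

theorem Rep.gluing_of_covBy (hf : Rep f) {a b : α} (h : a ⋖ b) : Gluing f (Set.Iic a) {b} := by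
  refine ⟨fun x hx y hy => hy ▸ hx.trans_lt h.lt, fun x y => ?_⟩
  obtain ⟨i, hi⟩ := hf.exists_Iic a
  obtain ⟨x', hx'⟩ := hf.exists_inter x i
  obtain ⟨y', hy'⟩ := hf.exists_inter y (hf.single b)
  obtain ⟨z, hz⟩ := hf.exists_union x' y'
  exact ⟨z, by rw [hz, hx', hy', hi, hf.apply_single]⟩

theorem Rep.rankType_singleton_eq (hf : Rep f) (hg : Rep g) (k : ℕ) (a : α) (b : β) :
    rankType f {a} k (default : Fin 0 → P) = rankType g {b} k (default : Fin 0 → Q) :=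
  rankType_singleton ⟨_, hf.bot⟩ hf.exists_univ ⟨_, hg.bot⟩ hg.exists_univ k fun i => i.elim0

theorem Rep.initType_eq_of_covBy (hf : Rep f) (hg : Rep g) {k : ℕ} {a b : α} {a' b' : β}
    (h : a ⋖ b) (h' : a' ⋖ b') (heq : initType f k a = initType g k a') :
    initType f k b = initType g k b' := by
  unfold initType
  rw [Iic_eq_union_of_covBy h, Iic_eq_union_of_covBy h']
  exact rankType_union (hf.gluing_of_covBy h) (hg.gluing_of_covBy h') k heq
    (hf.rankType_singleton_eq hg k b b')

theorem Rep.initType_eq_of_isBot (hf : Rep f) (hg : Rep g) (k : ℕ) {a : α} {a' : β}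
    (h : IsBot a) (h' : IsBot a') : initType f k a = initType g k a' := by
  have Iic_eq {γ : Type} [LinearOrder γ] {c : γ} (hc : IsBot c) : Set.Iic c = {c} :=
    Set.ext fun x => ⟨fun hx => le_antisymm hx (hc x), fun hx => hx.le⟩
  unfold initType
  rw [Iic_eq h, Iic_eq h']
  exact hf.rankType_singleton_eq hg k a a'

theorem Rep.initType_seq_eq (hf : Rep f) (hg : Rep g) (k : ℕ) {e : ℕ → α} {e' : ℕ → β}
    (h₀ : IsBot (e 0)) (h₀' : IsBot (e' 0)) (hs : ∀ n, e n ⋖ e (n + 1))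
    (hs' : ∀ n, e' n ⋖ e' (n + 1)) (n : ℕ) : initType f k (e n) = initType g k (e' n) := by
  induction n with
  | zero => exact hf.initType_eq_of_isBot hg k h₀ h₀'
  | succ n ih => exact hf.initType_eq_of_covBy hg (hs n) (hs' n) ih

/-- The types of the finite initial segments are ultimately periodic. -/
theorem Rep.exists_period (hf : Rep f) (k : ℕ) {e : ℕ → α} (hs : ∀ n, e n ⋖ e (n + 1)) :
    ∃ N d : ℕ, 1 < d ∧ ∀ m n, N ≤ m → N ≤ n → (m : ZMod d) = n →
      initType f k (e m) = initType f k (e n) := by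
  have := RankType.finite k 0
  obtain ⟨i, j, hne, hij⟩ := Finite.exists_ne_map_eq_of_infinite fun n => initType f k (e n)
  wlog hlt : i < j generalizing i j
  · exact this j i hne.symm hij.symm (by omega)
  obtain ⟨c, rfl⟩ := Nat.exists_eq_add_of_lt hlt
  have step (n : ℕ) : initType f k (e (i + n)) = initType f k (e (i + n + (c + 1))) := by
    induction n with
    | zero => exact hij
    | succ n ih =>
      rw [show i + (n + 1) + (c + 1) = i + n + (c + 1) + 1 by ring]
      exact hf.initType_eq_of_covBy hf (hs _) (hs _) ih
  have iter (l n : ℕ) : initType f k (e (i + n)) =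
      initType f k (e (i + n + l * (c + 1))) := by
    induction l with
    | zero => simp
    | succ l ih =>
      rw [ih, add_assoc i, step]
      congr 2
      ring
  refine ⟨i, 2 * (c + 1), by omega, fun m n hm hn h => ?_⟩
  wlog hmn : m ≤ n generalizing m n
  · exact (this n m hn hm h.symm (by omega)).symm
  rw [ZMod.natCast_eq_natCast_iff, Nat.modEq_iff_dvd' hmn] at h
  obtain ⟨l, hl⟩ := h
  obtain ⟨m, rfl⟩ := Nat.exists_eq_add_of_le hm
  rw [iter (l * 2) m]
  congr 2
  linarith [Nat.sub_add_cancel hmn]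

/-- Initial segments having a given type form a definable set. -/
theorem Rep.dfb_initType (hf : Rep f) (k : ℕ) (t : RankType k 0) :
    ∃ T : P → Prop, (Dfb fun v : Unit → P => T (v ())) ∧
      ∀ a, T (hf.single a) ↔ initType f k a = t := by
  refine ⟨fun x => ∃ u, (∀ s, atE s → (subE s u ↔ ¬ exleE x s)) ∧
    rankType f (f u) k (default : Fin 0 → P) = t, ?_, fun a => ?_⟩
  · refine Dfb.ex (S := fun (v : Unit → P) u => (∀ s, atE s → (subE s u ↔ ¬ exleE (v ()) s)) ∧
      rankType f (f u) k (default : Fin 0 → P) = t) (.and ?_ ?_)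
    · exact Dfb.all (S := fun (w : Unit ⊕ Unit → P) s =>
        atE s → (subE s (w (.inr ())) ↔ ¬ exleE (w (.inl ())) s)) ((Dfb.atom .inr).imp
        ((Dfb.sub .inr IsSlot.inr.inl).iff (Dfb.exle (IsSlot.var (Sum.inl ())).inl .inr).not))
    · refine (hf.dfb_rankType k (a := default) IsSlot.inr (fun i => i.elim0) t).congr fun v => ?_
      rw [Subsingleton.elim (fun i => (default : Fin 0 → (Unit ⊕ Unit → P) → P) i v) default]
  · simp only [hf.forall_atE, hf.single_sub, hf.single_exle, not_lt]
    have key (u : P) : (∀ b, b ∈ f u ↔ b ≤ a) ↔ f u = Set.Iic a := Set.ext_iff.symm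
    simp only [key, initType]
    obtain ⟨u, hu⟩ := hf.exists_Iic a
    exact ⟨fun ⟨u, hu, h⟩ => hu ▸ h, fun h => ⟨u, hu, hu ▸ h⟩⟩

/-- A pattern of types following a definable colouring propagates through a represented
order all of whose represented sets have least elements. -/
theorem Rep.initType_eq_of_color (hf : Rep f) {k d : ℕ} [NeZero d] {c : α → ZMod d}
    {G : ZMod d → RankType k 0} (hmin : ∀ x, (f x).Nonempty → ∃ a, IsLeast (f x) a)
    (hpred : ∀ a b : α, b < a → ∃ c, c ⋖ a) (hc : ∀ i, ∃ x, f x = c ⁻¹' {i})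
    (hcs : ∀ a b, a ⋖ b → c b = c a + 1)
    (hG : ∀ a b z, a ⋖ b → initType f k a = G z → initType f k b = G (z + 1)) {p a : α}
    (hp : initType f k p = G (c p)) (ha : p ≤ a) : initType f k a = G (c a) := by
  choose T hT hT' using fun z => hf.dfb_initType k (G z)
  choose A hA using hc
  obtain ⟨X, hX⟩ := hf.exists_eq_of_dfb (s := {x | p ≤ x ∧ initType f k x ≠ G (c x)})
    (S := fun x => ¬ exleE x (hf.single p) ∧ ¬ ∃ z, subE x (A z) ∧ T z x)
    ((Dfb.exle (.var ()) (.const _)).not.and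
      (Dfb.finite_ex fun z => (Dfb.sub (.var ()) (.const _)).and (hT z)).not) fun x y hy => by
      obtain rfl := hf.eq_single hy
      simp [hA, hT', hf.single_exle]
  by_contra hne
  obtain ⟨m, hm, hm'⟩ := hmin X ⟨a, by rw [hX]; exact ⟨ha, hne⟩⟩
  rw [hX] at hm hm'
  obtain ⟨hpm, hm⟩ := hm
  have hlt : p < m := lt_of_le_of_ne hpm fun h => hm (h ▸ hp)
  obtain ⟨l, hl⟩ := hpred m p hlt
  have hpl : p ≤ l := not_lt.1 fun h => hl.2 h hlt
  have : initType f k l = G (c l) := by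
    by_contra hne
    exact (hm' ⟨hpl, hne⟩).not_gt hl.lt
  exact hm (hcs l m hl ▸ hG l m _ hl this)

/-- Any two representations of models of `Trt rt` have the same types. -/
theorem Good.rankType_eq {rt : ℕ → ℕ} (hf : Rep f) (hg : Rep g) (gf : Good rt f) (gg : Good rt g)
    (k : ℕ) : rankType f Set.univ k (default : Fin 0 → P) =
      rankType g Set.univ k (default : Fin 0 → Q) := by
  have := gf.infinite
  have := gg.infinite
  obtain ⟨e, h₀, hs⟩ := exists_initial_seq gf.bot gf.succ
  obtain ⟨e', h₀', hs'⟩ := exists_initial_seq gg.bot gg.succ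
  have heq := hf.initType_seq_eq hg k h₀ h₀' hs hs'
  obtain ⟨N, d, hd, per⟩ := hf.exists_period k hs
  have : NeZero d := ⟨by omega⟩
  have hN (z : ZMod d) : N ≤ z.val + d * N := by nlinarith
  have hcast (z : ZMod d) : ((z.val + d * N : ℕ) : ZMod d) = z := by simp
  let G (z : ZMod d) : RankType k 0 := initType f k (e (z.val + d * N))
  have hG (n : ℕ) (hn : N ≤ n) : initType f k (e n) = G n :=
    per _ _ hn (hN _) (hcast _).symm
  have hsucc (z : ZMod d) : initType f k (e (z.val + d * N + 1)) = G (z + 1) := by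
    rw [hG _ ((hN z).trans (Nat.le_succ _)), Nat.cast_succ, hcast]
  obtain ⟨c, hc, hc₀, hcs, hct⟩ := gf.color d hd
  obtain ⟨c', hc', hc₀', hcs', hct'⟩ := gg.color d hd
  have ce (n : ℕ) : c (e n) = n := by
    induction n with
    | zero => simpa using hc₀ _ h₀
    | succ n ih => rw [hcs _ _ (hs n), ih, Nat.cast_succ]
  have ce' (n : ℕ) : c' (e' n) = n := by
    induction n with
    | zero => simpa using hc₀' _ h₀'
    | succ n ih => rw [hcs' _ _ (hs' n), ih, Nat.cast_succ]
  obtain ⟨t, ht⟩ := gf.top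
  obtain ⟨t', ht'⟩ := gg.top
  have key := hf.initType_eq_of_color gf.min gf.pred hc hcs (G := G)
    (fun a b z hab h => (hf.initType_eq_of_covBy hf hab (hs _) h).trans (hsucc z))
    (p := e N) (by rw [ce, hG N le_rfl]) (ht (e N))
  have key' := hg.initType_eq_of_color gg.min gg.pred hc' hcs' (G := G)
    (fun a b z hab h => (hg.initType_eq_of_covBy hf hab (hs _) h).trans (hsucc z))
    (p := e' N) (by rw [ce', ← heq, hG N le_rfl]) (ht' (e' N))
  have huniv : Set.Iic t = Set.univ := Set.eq_univ_of_forall ht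
  have huniv' : Set.Iic t' = Set.univ := Set.eq_univ_of_forall ht'
  rw [hct t ht] at key
  rw [hct' t' ht', ← key] at key'
  simpa only [initType, huniv, huniv'] using key'.symm

end Completeness

/-- The theories `Trt rt` are complete. -/
theorem realize_iff_of_models_trt {P Q : Type} [Lmso.Structure P] [Lmso.Structure Q] {rt : ℕ → ℕ}
    (hP : P ⊨ Trt rt) (hQ : Q ⊨ Trt rt) (φ : Lmso.Sentence) : P ⊨ φ ↔ Q ⊨ φ := by
  have base : Tbase ⊆ Trt rt := fun _ h => .inl (.inl (.inl h))
  obtain ⟨α, _, f, hf⟩ := exists_rep (hP.mono base)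
  obtain ⟨β, _, g, hg⟩ := exists_rep (hQ.mono base)
  have h := Good.rankType_eq hf hg ((hf.models_trt_iff rt).1 hP) ((hg.models_trt_iff rt).1 hQ) (qr φ)
  exact hf.realize_iff_of_rankType_eq hg φ le_rfl h

/-- A product of models of `Trt r₁` and `Trt r₂` is a model of the theory of the sum. -/
theorem models_trt_tensor {M N : Type} [Lmso.Structure M] [Lmso.Structure N] {r₁ r₂ : ℕ → ℕ}
    (hM : M ⊨ Trt r₁) (hN : N ⊨ Trt r₂) : (M × N) ⊨ Trt fun d => (r₁ d + r₂ d) % d := by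
  have base (rt : ℕ → ℕ) : Tbase ⊆ Trt rt := fun _ h => .inl (.inl (.inl h))
  obtain ⟨α, _, f, hf⟩ := exists_rep (hM.mono (base r₁))
  obtain ⟨β, _, g, hg⟩ := exists_rep (hN.mono (base r₂))
  exact ((hf.tensor hg).models_trt_iff _).2
    (((hf.models_trt_iff _).1 hM).tensor ((hg.models_trt_iff _).1 hN))

theorem IsResidueFunctionTilde.add {rt₁ rt₂ : ℕ → ℕ} (h₁ : IsResidueFunctionTilde rt₁)
    (h₂ : IsResidueFunctionTilde rt₂) :
    IsResidueFunctionTilde fun d => (rt₁ d + rt₂ d) % d := by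
  obtain ⟨r₁, hr₁, h₁⟩ := h₁
  obtain ⟨r₂, hr₂, h₂⟩ := h₂
  refine ⟨fun p j => (r₁ p j + r₂ p j) % p ^ j, fun p j hp hj => ⟨Nat.mod_lt _ (pow_pos hp.pos _),
    ?_⟩, fun d hd => ⟨Nat.mod_lt _ (by omega), fun p j hp hj hpd => ?_⟩⟩
  · exact (((Nat.mod_modEq _ _).of_dvd (pow_dvd_pow p j.le_succ)).trans
      ((hr₁ p j hp hj).2.add (hr₂ p j hp hj).2)).trans (Nat.mod_modEq _ _).symm
  · exact (((Nat.mod_modEq _ _).of_dvd hpd).trans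
      (((h₁ d hd).2 p j hp hj hpd).add ((h₂ d hd).2 p j hp hj hpd))).trans (Nat.mod_modEq _ _).symm

theorem statement17 (rt₁ rt₂ : ℕ → ℕ)
    (h₁ : IsResidueFunctionTilde rt₁) (h₂ : IsResidueFunctionTilde rt₂) :
    IsResidueFunctionTilde (fun d => (rt₁ d + rt₂ d) % d) ∧
    ∀ (M N : Type) [Lmso.Structure M] [Lmso.Structure N],
      M ⊨ Trt rt₁ → N ⊨ Trt rt₂ →
      ∀ φ : Lmso.Sentence, ((M × N) ⊨ φ ↔ Trt (fun d => (rt₁ d + rt₂ d) % d) ⊨ᵇ φ) := by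
  refine ⟨h₁.add h₂, fun M N _ _ hM hN φ => ?_⟩
  have hMN := models_trt_tensor hM hN
  have : Nonempty (M × N) := ⟨botE (M × N)⟩
  refine ⟨fun h => ?_, fun h => h.realize_sentence (M × N)⟩
  rw [Theory.models_sentence_iff]
  exact fun P => (realize_iff_of_models_trt hMN P.is_model φ).1 h

end MSO
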